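/- arXiv:1101.4469 — 2 statements merged into one kernel-verified Lean document; each statement's English description precedes it below -/
import Mathlib

section
/- Let M be the tridiagonal (2m+2)×(2m+2) matrix with zero diagonal and off-diagonal entries J_k = √((k+1)(2m+1-k)) for k odd and J_k = √((k+2α+2)(2m+2β-k)) for k even (k = 0,…,2m). Then the eigenvalues of M are ±2√((α+k+1)(β+k)) for k = 0,1,…,m, and an orthonormal basis of eigenvectors is given by the columns of the matrix U built from Hahn polynomials: the column with index m-k (eigenvalue -2√((α+k+1)(β+k))) has entries ((-1)^i/√2)·Q̃_k(i;α,β,m) in row 2i and -((-1)^i/√2)·Q̃_k(i;α+1,β-1,m) in row 2i+1; the column m+k+1 (eigenvalue +2√((α+k+1)(β+k))) has the same even-row entries and opposite odd-row entries. -/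
open Finset Matrix

/-- Pochhammer symbol `(a)_k = a(a+1)⋯(a+k-1)`. -/
noncomputable def poch (a : ℝ) (k : ℕ) : ℝ := ∏ i ∈ Finset.range k, (a + i)

/-- The Hahn polynomial `Q_n(x;α,β,m)` as a terminating ₃F₂ series. -/
noncomputable def hahnQ (n : ℕ) (x α β : ℝ) (m : ℕ) : ℝ :=
  ∑ k ∈ Finset.range (n + 1),
    poch (-(n : ℝ)) k * poch ((n : ℝ) + α + β + 1) k * poch (-x) k /
      ((k.factorial : ℝ) * poch (α + 1) k * poch (-(m : ℝ)) k)

/-- The Hahn weight `w(x;α,β,m) = C(α+x,x) C(m+β-x,m-x)`. -/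
noncomputable def hahnW (x : ℕ) (α β : ℝ) (m : ℕ) : ℝ :=
  (poch (α + 1) x / (x.factorial : ℝ)) * (poch (β + 1) (m - x) / ((m - x).factorial : ℝ))

/-- The squared norm `h_n(α,β,m)` of the Hahn polynomials. -/
noncomputable def hahnH (n : ℕ) (α β : ℝ) (m : ℕ) : ℝ :=
  ((-1 : ℝ) ^ n * poch ((n : ℝ) + α + β + 1) (m + 1) * poch (β + 1) n * (n.factorial : ℝ)) /
    ((2 * (n : ℝ) + α + β + 1) * poch (α + 1) n * poch (-(m : ℝ)) n * (m.factorial : ℝ))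

/-- Orthonormal Hahn function `Q̃_n(x;α,β,m)`. -/
noncomputable def hahnQt (n x : ℕ) (α β : ℝ) (m : ℕ) : ℝ :=
  Real.sqrt (hahnW x α β m) * hahnQ n (x : ℝ) α β m / Real.sqrt (hahnH n α β m)

/-- The matrix `U` of eigenvectors, built from Hahn polynomials with
parameters `(α,β)` (even rows) and `(α+1,β-1)` (odd rows). -/
noncomputable def hahnU (α β : ℝ) (m : ℕ) : Matrix (Fin (2 * m + 2)) (Fin (2 * m + 2)) ℝ :=
  Matrix.of fun r c =>
    let i : ℕ := (r : ℕ) / 2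
    let j : ℕ := if (c : ℕ) ≤ m then m - (c : ℕ) else (c : ℕ) - m - 1
    if (r : ℕ) % 2 = 0 then
      ((-1 : ℝ) ^ i / Real.sqrt 2) * hahnQt j i α β m
    else
      (if (c : ℕ) ≤ m then (-1 : ℝ) else 1) * ((-1 : ℝ) ^ i / Real.sqrt 2)
        * hahnQt j i (α + 1) (β - 1) m

/-- The spin chain couplings `J_k`. -/
noncomputable def hahnJ (α β : ℝ) (m : ℕ) (k : ℕ) : ℝ :=
  if k % 2 = 1 then Real.sqrt (((k : ℝ) + 1) * ((2 * m + 1 : ℝ) - k))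
  else Real.sqrt (((k : ℝ) + 2 * α + 2) * ((2 * m : ℝ) + 2 * β - k))

/-- The tridiagonal single-excitation interaction matrix `M`. -/
noncomputable def hahnM (α β : ℝ) (m : ℕ) : Matrix (Fin (2 * m + 2)) (Fin (2 * m + 2)) ℝ :=
  Matrix.of fun r c =>
    if (r : ℕ) + 1 = (c : ℕ) then hahnJ α β m r
    else if (c : ℕ) + 1 = (r : ℕ) then hahnJ α β m c
    else 0

/-- The eigenvalues `ε_{m-k} = -2√((α+k+1)(β+k))`, `ε_{m+k+1} = 2√((α+k+1)(β+k))`. -/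
noncomputable def hahnEps (α β : ℝ) (m : ℕ) (c : Fin (2 * m + 2)) : ℝ :=
  if (c : ℕ) ≤ m then
    -2 * Real.sqrt ((α + (m - (c : ℕ) : ℕ) + 1) * (β + (m - (c : ℕ) : ℕ)))
  else
    2 * Real.sqrt ((α + ((c : ℕ) - m - 1 : ℕ) + 1) * (β + ((c : ℕ) - m - 1 : ℕ)))

/-- The correlation function `f_{r,s}(t)`. -/
noncomputable def hahnCorr (α β : ℝ) (m : ℕ) (r s : Fin (2 * m + 2)) (t : ℝ) : ℂ :=
  ∑ j : Fin (2 * m + 2),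
    ((hahnU α β m r j * hahnU α β m s j : ℝ) : ℂ)
      * Complex.exp (-Complex.I * t * (hahnEps α β m j : ℝ))

lemma poch_zero (a : ℝ) : poch a 0 = 1 := by simp [poch]

lemma poch_succ (a : ℝ) (k : ℕ) : poch a (k + 1) = poch a k * (a + k) := by
  simp [poch, Finset.prod_range_succ]

lemma poch_succ' (a : ℝ) (k : ℕ) : poch a (k + 1) = a * poch (a + 1) k := by
  simp only [poch, Finset.prod_range_succ']
  rw [mul_comm]
  congr 1
  · simp
  · apply Finset.prod_congr rfl
    intro i _
    push_cast
    ring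

lemma poch_pos {a : ℝ} (ha : 0 < a) (k : ℕ) : 0 < poch a k := by
  apply Finset.prod_pos
  intro i _
  positivity

lemma poch_shift (a : ℝ) (k : ℕ) : poch a k * (a + k) = a * poch (a + 1) k := by
  rw [← poch_succ, poch_succ']

lemma poch_neg_ne (m k : ℕ) (h : k ≤ m) : poch (-(m : ℝ)) k ≠ 0 := by
  apply Finset.prod_ne_zero_iff.mpr
  intro i hi
  have : i < m := lt_of_lt_of_le (Finset.mem_range.mp hi) h
  have h2 : (i : ℝ) < m := by exact_mod_cast this
  intro h3
  linarith

/-- coefficients of the Hahn polynomial -/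
noncomputable def hc (n : ℕ) (α β : ℝ) (m k : ℕ) : ℝ :=
  poch (-(n : ℝ)) k * poch ((n : ℝ) + α + β + 1) k /
      ((k.factorial : ℝ) * poch (α + 1) k * poch (-(m : ℝ)) k)

lemma hahnQ_eq (n : ℕ) (x α β : ℝ) (m : ℕ) :
    hahnQ n x α β m = ∑ k ∈ Finset.range (n + 1), hc n α β m k * poch (-x) k := by
  unfold hahnQ hc
  apply Finset.sum_congr rfl
  intro k _
  ring

lemma hc_succ (n : ℕ) (α β : ℝ) (m k : ℕ) (hα : -1 < α) (hk : k < m) :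
    hc n α β m (k + 1) * ((k + 1) * (k + 1 + α) * (k - m)) =
      hc n α β m k * ((k - n) * (n + k + α + β + 1)) := by
  unfold hc
  have h1 : poch (α + 1) k ≠ 0 := (poch_pos (by linarith) k).ne'
  have h2 := poch_neg_ne m k hk.le
  have h3 : (k.factorial : ℝ) ≠ 0 := by positivity
  have h4 : (k : ℝ) + 1 ≠ 0 := by positivity
  have h5 : (α + 1 + k : ℝ) ≠ 0 := by
    have : (0 : ℝ) ≤ k := by positivity
    intro h; linarith
  have h6 : (-(m : ℝ) + k) ≠ 0 := by
    have h2 : (k : ℝ) < m := by exact_mod_cast hk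
    intro h; linarith
  simp only [poch_succ, Nat.factorial_succ]
  push_cast
  field_simp
  ring

lemma phi_down (x : ℝ) (k : ℕ) : x * poch (-(x - 1)) k = (x - k) * poch (-x) k := by
  have h := poch_shift (-x) k
  rw [show -(x - 1) = -x + 1 by ring]
  linarith

lemma phi_up (x : ℝ) (k : ℕ) : poch (-(x + 1)) (k + 1) = poch (-x) (k + 1) - (k + 1) * poch (-x) k := by
  rw [poch_succ', poch_succ, show -(x + 1) + 1 = -x by ring]
  ring

/-- even rows -/
lemma hahnQ_even (n : ℕ) (x α β : ℝ) (m : ℕ) (hα : -1 < α) :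
    (x + α + 1) * hahnQ n x (α + 1) (β - 1) m - x * hahnQ n (x - 1) (α + 1) (β - 1) m =
      (α + 1) * hahnQ n x α β m := by
  simp only [hahnQ, Finset.mul_sum]
  rw [← Finset.sum_sub_distrib]
  apply Finset.sum_congr rfl
  intro k _
  have h1 : poch (α + 1) k ≠ 0 := (poch_pos (by linarith) k).ne'
  have h1' : poch (α + 1 + 1) k ≠ 0 := (poch_pos (by linarith) k).ne'
  have h2 := poch_shift (α + 1) k
  have h3 := phi_down x k
  rw [show (n : ℝ) + (α + 1) + (β - 1) + 1 = n + α + β + 1 by ring]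
  set A := poch (-(n : ℝ)) k * poch ((n : ℝ) + α + β + 1) k / ((k.factorial : ℝ) * poch (-(m : ℝ)) k) with hA
  have e1 : ∀ y c, poch (-(n : ℝ)) k * poch ((n : ℝ) + α + β + 1) k * y /
      ((k.factorial : ℝ) * c * poch (-(m : ℝ)) k) = A * (y / c) := by
    intro y c
    rw [hA, mul_right_comm (k.factorial : ℝ) c, ← div_mul_div_comm]
  rw [e1, e1, e1]
  have e2 : (α + 1) * (A * (poch (-x) k / poch (α + 1) k)) =
      A * ((α + 1 + k) * poch (-x) k / poch (α + 1 + 1) k) := by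
    rw [mul_left_comm]
    congr 1
    field_simp
    linear_combination (-poch (-x) k) * h2
  rw [e2]
  have e3 : x * (A * (poch (-(x - 1)) k / poch (α + 1 + 1) k)) =
      A * ((x * poch (-(x - 1)) k) / poch (α + 1 + 1) k) := by ring
  rw [e3, h3]
  ring

lemma hc_shift (n : ℕ) (α β : ℝ) (m k : ℕ) (hα : -1 < α) :
    hc n α β m k * (α + 1) = hc n (α + 1) (β - 1) m k * (k + 1 + α) := by
  have h1 : poch (α + 1) k ≠ 0 := (poch_pos (by linarith) k).ne'
  have h1' : poch (α + 1 + 1) k ≠ 0 := (poch_pos (by linarith) k).ne'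
  have h2 := poch_shift (α + 1) k
  unfold hc
  rw [show (n : ℝ) + (α + 1) + (β - 1) + 1 = n + α + β + 1 by ring]
  set P := poch (-(n : ℝ)) k * poch ((n : ℝ) + α + β + 1) k
  rw [mul_right_comm (k.factorial : ℝ) (poch (α + 1) k), mul_right_comm (k.factorial : ℝ) (poch (α + 1 + 1) k),
    div_mul_eq_div_div P _ (poch (α + 1) k), div_mul_eq_div_div P _ (poch (α + 1 + 1) k)]
  generalize P / ((k.factorial : ℝ) * poch (-(m : ℝ)) k) = R
  field_simp
  linear_combination (-R) * h2

/-- telescoping principle: sum of `a k φ k + b (k+1) φ k`. -/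
lemma sum_tel (n : ℕ) (a b φ : ℕ → ℝ) :
    ∑ k ∈ Finset.range (n + 1), (a k * φ k + b k * φ (k - 1)) =
      ∑ k ∈ Finset.range n, (a k + b (k + 1)) * φ k + a n * φ n + b 0 * φ 0 := by
  rw [Finset.sum_add_distrib, Finset.sum_range_succ, Finset.sum_range_succ' (fun k => b k * φ (k - 1))]
  simp only [add_mul, Finset.sum_add_distrib, Nat.add_sub_cancel, Nat.zero_sub]
  ring

/-- odd rows -/
lemma hahnQ_odd (n : ℕ) (x α β : ℝ) (m : ℕ) (hn : n ≤ m) (hα : -1 < α) :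
    (m + β - x) * hahnQ n x α β m - (m - x) * hahnQ n (x + 1) α β m =
      (β + n) * (α + 1 + n) / (α + 1) * hahnQ n x (α + 1) (β - 1) m := by
  have hα1 : α + 1 ≠ 0 := by intro h; linarith
  have key : (m + β - x) * hahnQ n x α β m - (m - x) * hahnQ n (x + 1) α β m =
      ∑ k ∈ Finset.range (n + 1), ((hc n α β m k * (β + k)) * poch (-x) k +
        (hc n α β m k * (k * (m - k + 1))) * poch (-x) (k - 1)) := by
    simp only [hahnQ_eq, Finset.mul_sum]
    rw [← Finset.sum_sub_distrib]
    apply Finset.sum_congr rfl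
    intro k _
    rcases k with _ | k
    · simp [poch_zero]; ring
    · rw [phi_up, Nat.add_sub_cancel, poch_succ]
      push_cast
      ring
  rw [key, sum_tel, hahnQ_eq, Finset.sum_range_succ, mul_add _ (Finset.sum _ _), Finset.mul_sum]
  have e0 : ∀ k, hc n (α + 1) (β - 1) m k * (k + 1 + α) = hc n α β m k * (α + 1) :=
    fun k => (hc_shift n α β m k hα).symm
  have e1 : ∀ k ∈ Finset.range n, (hc n α β m k * (β + k) +
      hc n α β m (k + 1) * (((k + 1 : ℕ) : ℝ) * (m - ((k + 1 : ℕ) : ℝ) + 1))) * poch (-x) k =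
      (β + n) * (α + 1 + n) / (α + 1) * (hc n (α + 1) (β - 1) m k * poch (-x) k) := by
    intro k hk
    have hk' : k < n := Finset.mem_range.mp hk
    have h1 := hc_succ n α β m k hα (by omega)
    have h2 := e0 k
    have h5 : (k + 1 + α : ℝ) ≠ 0 := by
      have : (0 : ℝ) ≤ k := by positivity
      intro h; linarith
    rw [← mul_assoc _ _ (poch (-x) k)]
    congr 1
    rw [div_mul_eq_mul_div, eq_div_iff hα1]
    apply mul_right_cancel₀ h5
    push_cast
    linear_combination (-(α + 1)) * h1 - (β + n) * (α + 1 + n) * h2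
  rw [Finset.sum_congr rfl e1]
  have h2 := e0 n
  have : hc n α β m n * (β + n) = (β + n) * (α + 1 + n) / (α + 1) * hc n (α + 1) (β - 1) m n := by
    rw [div_mul_eq_mul_div, eq_div_iff hα1]
    linear_combination (-(β + n)) * h2
  rw [this]
  simp
  ring

/-- difference equation -/
lemma hahnQ_diff (n : ℕ) (x α β : ℝ) (m : ℕ) (hn : n ≤ m) (hα : -1 < α) :
    (x + α + 1) * (x - m) * (hahnQ n (x + 1) α β m - hahnQ n x α β m) +
      x * (x - β - m - 1) * (hahnQ n (x - 1) α β m - hahnQ n x α β m) =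
      n * (n + α + β + 1) * hahnQ n x α β m := by
  have key : (x + α + 1) * (x - m) * (hahnQ n (x + 1) α β m - hahnQ n x α β m) +
      x * (x - β - m - 1) * (hahnQ n (x - 1) α β m - hahnQ n x α β m) =
      ∑ k ∈ Finset.range (n + 1), ((hc n α β m k * (k * (k + α + β + 1))) * poch (-x) k +
        (-hc n α β m k * (k * (k + α) * (k - 1 - m))) * poch (-x) (k - 1)) := by
    simp only [hahnQ_eq]
    rw [← Finset.sum_sub_distrib, ← Finset.sum_sub_distrib, Finset.mul_sum, Finset.mul_sum,
      ← Finset.sum_add_distrib]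
    apply Finset.sum_congr rfl
    intro k _
    have h3 := phi_down x k
    rcases k with _ | k
    · simp [poch_zero]
    · have h4 := phi_up x k
      rw [poch_succ (-x) k] at h3 h4 ⊢
      rw [Nat.add_sub_cancel, h4]
      push_cast at h3 ⊢
      linear_combination hc n α β m (k+1) * (x - β - m - 1) * h3
  rw [key, sum_tel, hahnQ_eq, Finset.sum_range_succ, mul_add _ (Finset.sum _ _), Finset.mul_sum]
  have e1 : ∀ k ∈ Finset.range n, (hc n α β m k * (k * (k + α + β + 1)) +
      -hc n α β m (k + 1) * (((k + 1 : ℕ) : ℝ) * (((k + 1 : ℕ) : ℝ) + α) * (((k + 1 : ℕ) : ℝ) - 1 - m))) * poch (-x) k =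
      n * (n + α + β + 1) * (hc n α β m k * poch (-x) k) := by
    intro k hk
    have hk' : k < n := Finset.mem_range.mp hk
    have h1 := hc_succ n α β m k hα (by omega)
    rw [← mul_assoc _ _ (poch (-x) k)]
    congr 1
    push_cast
    linear_combination -h1
  rw [Finset.sum_congr rfl e1]
  simp
  ring

/-- forward shift -/
lemma hahnQ_fwd (n : ℕ) (x α β : ℝ) (m : ℕ) (hn : n ≤ m) (hα : -1 < α) :
    hahnQ (n + 1) (x + 1) α β (m + 1) - hahnQ (n + 1) x α β (m + 1) =
      -((n + 1) * (n + α + β + 2)) / ((α + 1) * (m + 1)) * hahnQ n x (α + 1) (β + 1) m := by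
  have hα1 : α + 1 ≠ 0 := by intro h; linarith
  simp only [hahnQ_eq]
  rw [← Finset.sum_sub_distrib, Finset.sum_range_succ', Finset.mul_sum]
  simp only [poch_zero, sub_self, add_zero]
  apply Finset.sum_congr rfl
  intro k hk
  have hk' : k ≤ m := by have := Finset.mem_range.mp hk; omega
  rw [phi_up]
  unfold hc
  simp only [poch_succ', Nat.factorial_succ]
  push_cast
  rw [show -((n : ℝ) + 1) + 1 = -n by ring, show -((m : ℝ) + 1) + 1 = -m by ring,
    show (n : ℝ) + 1 + α + β + 1 + 1 = n + (α + 1) + (β + 1) + 1 by ring]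
  have h1' : poch (α + 1 + 1) k ≠ 0 := (poch_pos (by linarith) k).ne'
  have h2 := poch_neg_ne m k hk'
  have h3 : (k.factorial : ℝ) ≠ 0 := by positivity
  have h4 : (k : ℝ) + 1 ≠ 0 := by positivity
  have h5 : (m : ℝ) + 1 ≠ 0 := by positivity
  have h6 : -((m : ℝ) + 1) ≠ 0 := neg_ne_zero.mpr h5
  field_simp
  ring

lemma vander (m : ℕ) : ∀ a b : ℝ, ∑ x ∈ Finset.range (m + 1),
    (poch a x / (x.factorial : ℝ)) * (poch b (m - x) / ((m - x).factorial : ℝ)) =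
      poch (a + b) m / (m.factorial : ℝ) := by
  induction m with
  | zero => intro a b; simp [poch_zero]
  | succ m ih =>
    intro a b
    have hm : (m : ℝ) + 1 ≠ 0 := by positivity
    have hs : ∀ (c : ℝ) (k : ℕ), ((k : ℝ) + 1) * (poch c (k + 1) / ((k + 1).factorial : ℝ)) =
        c * (poch (c + 1) k / (k.factorial : ℝ)) := by
      intro c k
      rw [poch_succ', Nat.factorial_succ]
      push_cast
      have h3 : (k.factorial : ℝ) ≠ 0 := by positivity
      have h4 : (k : ℝ) + 1 ≠ 0 := by positivity
      field_simp
    apply mul_left_cancel₀ hm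
    rw [hs, show a + b + 1 = (a + 1) + b by ring]
    have i1 := ih (a + 1) b
    have i2 := ih a (b + 1)
    rw [show a + (b + 1) = a + 1 + b by ring] at i2
    rw [add_mul a b]
    nth_rw 1 [← i1]
    rw [← i2, Finset.mul_sum, Finset.mul_sum, Finset.mul_sum]
    have split : ∀ x ∈ Finset.range (m + 1 + 1), ((m : ℝ) + 1) * ((poch a x / (x.factorial : ℝ)) *
        (poch b (m + 1 - x) / ((m + 1 - x).factorial : ℝ))) =
        (x : ℝ) * (poch a x / (x.factorial : ℝ)) *
        (poch b (m + 1 - x) / ((m + 1 - x).factorial : ℝ)) +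
        (poch a x / (x.factorial : ℝ)) * (((m + 1 - x : ℕ) : ℝ) *
        (poch b (m + 1 - x) / ((m + 1 - x).factorial : ℝ))) := by
      intro x hx
      have : x ≤ m + 1 := by have := Finset.mem_range.mp hx; omega
      rw [Nat.cast_sub this]
      push_cast
      ring
    rw [Finset.sum_congr rfl split, Finset.sum_add_distrib]
    congr 1
    · rw [Finset.sum_range_succ']
      simp only [Nat.cast_zero, zero_mul, add_zero]
      apply Finset.sum_congr rfl
      intro k _
      rw [Nat.add_sub_add_right]
      push_cast
      rw [hs]
      ring
    · rw [Finset.sum_range_succ]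
      simp only [Nat.sub_self, Nat.cast_zero, zero_mul, mul_zero, add_zero]
      apply Finset.sum_congr rfl
      intro k hk
      have : k ≤ m := by have := Finset.mem_range.mp hk; omega
      rw [Nat.succ_sub this]
      push_cast
      rw [hs]
      ring

lemma hahnW_pos (x : ℕ) (α β : ℝ) (m : ℕ) (hα : -1 < α) (hβ : -1 < β) : 0 < hahnW x α β m := by
  unfold hahnW
  have h1 := poch_pos (show 0 < α + 1 by linarith) x
  have h2 := poch_pos (show 0 < β + 1 by linarith) (m - x)
  positivity

lemma hahnW_shift (x d : ℕ) (α β : ℝ) :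
    hahnW x α β (x + d + 1) * ((x + α + 1) * (d + 1)) =
      (α + 1) * (β + 1) * hahnW x (α + 1) (β + 1) (x + d) := by
  unfold hahnW
  rw [show x + d + 1 - x = d + 1 by omega, show x + d - x = d by omega, poch_succ' (β + 1)]
  have h := poch_shift (α + 1) x
  have h3 : (x.factorial : ℝ) ≠ 0 := by positivity
  have h4 : (d.factorial : ℝ) ≠ 0 := by positivity
  have h5 : (d : ℝ) + 1 ≠ 0 := by positivity
  rw [Nat.factorial_succ]
  push_cast
  field_simp
  linear_combination h * poch (β + 1 + 1) d * (β + 1)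

lemma hahnW_shift2 (x d : ℕ) (α β : ℝ) :
    hahnW (x + 1) α β (x + d + 1) * ((x + 1) * (d + 1 + β)) =
      (α + 1) * (β + 1) * hahnW x (α + 1) (β + 1) (x + d) := by
  unfold hahnW
  rw [show x + d + 1 - (x + 1) = d by omega, show x + d - x = d by omega, poch_succ' (α + 1)]
  have h := poch_shift (β + 1) d
  have h3 : (x.factorial : ℝ) ≠ 0 := by positivity
  have h4 : (d.factorial : ℝ) ≠ 0 := by positivity
  have h5 : (x : ℝ) + 1 ≠ 0 := by positivity
  rw [Nat.factorial_succ]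
  push_cast
  field_simp
  linear_combination h * poch (α + 1 + 1) x * (α + 1)

lemma hahnW_odd (i d : ℕ) (α β : ℝ) :
    hahnW i (α + 1) (β - 1) (i + d) * ((α + 1) * (β + d)) =
      hahnW i α β (i + d) * (β * (α + 1 + i)) := by
  unfold hahnW
  rw [show i + d - i = d by omega, show β - 1 + 1 = β by ring]
  have h := poch_shift (α + 1) i
  have h' := poch_shift β d
  have h3 : (i.factorial : ℝ) ≠ 0 := by positivity
  have h4 : (d.factorial : ℝ) ≠ 0 := by positivity
  field_simp
  linear_combination (α + 1) * poch (α + 1 + 1) i * h' - β * poch (β + 1) d * h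

lemma hahnW_even (i d : ℕ) (α β : ℝ) :
    hahnW i (α + 1) (β - 1) (i + 1 + d) * ((α + 1) * (d + 1)) =
      hahnW (i + 1) α β (i + 1 + d) * (β * (i + 1)) := by
  unfold hahnW
  rw [show i + 1 + d - i = d + 1 by omega, show i + 1 + d - (i + 1) = d by omega,
    show β - 1 + 1 = β by ring, poch_succ' (α + 1), poch_succ' β]
  have h3 : (i.factorial : ℝ) ≠ 0 := by positivity
  have h4 : (d.factorial : ℝ) ≠ 0 := by positivity
  have h5 : (i : ℝ) + 1 ≠ 0 := by positivity
  have h6 : (d : ℝ) + 1 ≠ 0 := by positivity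
  rw [Nat.factorial_succ, Nat.factorial_succ]
  push_cast
  field_simp

lemma hahnH_shift (n : ℕ) (α β : ℝ) (m : ℕ) (hn : n ≤ m) (hα : -1 < α)
    (hs : 0 < α + β + 1) :
    hahnH n (α + 1) (β - 1) m * ((β + n) * (α + 1 + n)) = hahnH n α β m * (β * (α + 1)) := by
  unfold hahnH
  rw [show (n : ℝ) + (α + 1) + (β - 1) + 1 = n + α + β + 1 by ring,
    show 2 * (n : ℝ) + (α + 1) + (β - 1) + 1 = 2 * n + α + β + 1 by ring,
    show β - 1 + 1 = β by ring]
  have h := poch_shift (α + 1) n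
  have h' := poch_shift β n
  have h1 : poch (α + 1) n ≠ 0 := (poch_pos (by linarith) n).ne'
  have h1' : poch (α + 1 + 1) n ≠ 0 := (poch_pos (by linarith) n).ne'
  have h2 := poch_neg_ne m n hn
  have h3 : (m.factorial : ℝ) ≠ 0 := by positivity
  have h4 : 2 * (n : ℝ) + α + β + 1 ≠ 0 := by
    have : (0 : ℝ) ≤ n := by positivity
    intro h; linarith
  rw [div_mul_eq_mul_div, div_mul_eq_mul_div, div_eq_div_iff (by positivity) (by positivity)]
  generalize poch (-(m : ℝ)) n = A
  generalize poch ((n : ℝ) + α + β + 1) (m + 1) = B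
  generalize poch (α + 1) n = C at *
  generalize poch (α + 1 + 1) n = D at *
  generalize poch β n = E at *
  generalize poch (β + 1) n = F at *
  generalize (-1 : ℝ) ^ n = G
  linear_combination G * B * n.factorial * (2 * n + α + β + 1) * A * m.factorial *
    ((α + 1 + n) * C * h' + β * F * h)

lemma hahnH_pos (n : ℕ) (α β : ℝ) (m : ℕ) (hn : n ≤ m) (hα : -1 < α) (hβ : -1 < β)
    (hs : 0 < α + β + 1) : 0 < hahnH n α β m := by
  have key : 0 < (-1 : ℝ) ^ n * poch (-(m : ℝ)) n := by
    induction n with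
    | zero => simp [poch_zero]
    | succ n ih =>
      have h1 := ih (by omega)
      rw [poch_succ, pow_succ]
      have h2 : (n : ℝ) < m := by exact_mod_cast hn
      nlinarith [mul_pos h1 (sub_pos.mpr h2)]
  have hn0 : (0 : ℝ) ≤ n := by positivity
  have h1 := poch_pos (show 0 < (n : ℝ) + α + β + 1 by linarith) (m + 1)
  have h2 := poch_pos (show 0 < β + 1 by linarith) n
  have h3 := poch_pos (show 0 < α + 1 by linarith) n
  have h4 : 0 < 2 * (n : ℝ) + α + β + 1 := by linarith
  have h5 := poch_neg_ne m n hn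
  have e : hahnH n α β m = ((-1 : ℝ) ^ n * poch (-(m : ℝ)) n) *
      (poch ((n : ℝ) + α + β + 1) (m + 1) * poch (β + 1) n * (n.factorial : ℝ)) /
    ((2 * (n : ℝ) + α + β + 1) * poch (α + 1) n * poch (-(m : ℝ)) n ^ 2 * (m.factorial : ℝ)) := by
    unfold hahnH
    field_simp
  rw [e]
  positivity

lemma hahnH_rec (n : ℕ) (α β : ℝ) (m : ℕ) (hn : n ≤ m) (hα : -1 < α) (hs : 0 < α + β + 1) :
    hahnH (n + 1) α β (m + 1) = (β + 1) * ((n + 1) * (n + α + β + 2)) / ((α + 1) * (m + 1) ^ 2) *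
      hahnH n (α + 1) (β + 1) m := by
  unfold hahnH
  rw [poch_succ' _ (m + 1), poch_succ' (β + 1), poch_succ' (α + 1), poch_succ' (-((m + 1 : ℕ) : ℝ)),
    Nat.factorial_succ, Nat.factorial_succ]
  push_cast
  rw [show -((m : ℝ) + 1) + 1 = -m by ring,
    show (n : ℝ) + 1 + α + β + 1 + 1 = n + (α + 1) + (β + 1) + 1 by ring,
    show 2 * ((n : ℝ) + 1) + α + β + 1 = 2 * n + (α + 1) + (β + 1) + 1 by ring]
  have h1' : poch (α + 1 + 1) n ≠ 0 := (poch_pos (by linarith) n).ne'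
  have h2 := poch_neg_ne m n hn
  have h3 : (m.factorial : ℝ) ≠ 0 := by positivity
  have h5 : (m : ℝ) + 1 ≠ 0 := by positivity
  have h6 : -((m : ℝ) + 1) ≠ 0 := neg_ne_zero.mpr h5
  have hα1 : α + 1 ≠ 0 := by intro h; linarith
  have h4 : 2 * (n : ℝ) + (α + 1) + (β + 1) + 1 ≠ 0 := by
    have : (0 : ℝ) ≤ n := by positivity
    intro h; linarith
  rw [div_mul_div_comm, div_eq_div_iff (by positivity) (by positivity)]
  ring

lemma abel (P g : ℕ → ℝ) (m : ℕ) :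
    ∑ x ∈ Finset.range (m + 1), (-P x + (if x = 0 then 0 else P (x - 1))) * g x =
      ∑ x ∈ Finset.range m, P x * (g (x + 1) - g x) - P m * g m := by
  induction m with
  | zero => simp
  | succ m ih =>
    rw [Finset.sum_range_succ, ih, Finset.sum_range_succ _ m]
    simp
    ring

lemma hahn_step (n : ℕ) (α β : ℝ) (m : ℕ) (hn : n ≤ m + 1) (hα : -1 < α) (g : ℕ → ℝ) :
    n * (n + α + β + 1) * ∑ x ∈ Finset.range (m + 2), hahnW x α β (m + 1) * hahnQ n x α β (m + 1) * g x =
    ∑ x ∈ Finset.range (m + 1), (α + 1) * (β + 1) * hahnW x (α + 1) (β + 1) m *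
      (hahnQ n (x + 1) α β (m + 1) - hahnQ n x α β (m + 1)) * (g (x + 1) - g x) := by
  set P : ℕ → ℝ := fun x => hahnW x α β (m + 1) * ((x + α + 1) * (m + 1 - x)) *
    (hahnQ n (x + 1) α β (m + 1) - hahnQ n x α β (m + 1)) with hP
  have h0 : P (m + 1) = 0 := by simp [hP]
  have h1 : ∀ x ∈ Finset.range (m + 1), (α + 1) * (β + 1) * hahnW x (α + 1) (β + 1) m *
      (hahnQ n (x + 1) α β (m + 1) - hahnQ n x α β (m + 1)) * (g (x + 1) - g x) =
      P x * (g (x + 1) - g x) := by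
    intro x hx
    obtain ⟨d, rfl⟩ := Nat.exists_eq_add_of_le (show x ≤ m by have := Finset.mem_range.mp hx; omega)
    rw [← hahnW_shift, hP]
    push_cast
    ring
  rw [Finset.sum_congr rfl h1, Finset.mul_sum]
  have h2 := abel P g (m + 1)
  rw [h0, zero_mul, sub_zero] at h2
  rw [← h2]
  apply Finset.sum_congr rfl
  intro x hx
  have h3 := hahnQ_diff n x α β (m + 1) hn hα
  rw [← mul_assoc]
  congr 1
  rw [mul_left_comm, ← h3]
  rcases x with _ | x
  · simp [hP]
    ring
  · obtain ⟨d, rfl⟩ := Nat.exists_eq_add_of_le (show x ≤ m by have := Finset.mem_range.mp hx; omega)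
    have e1 := hahnW_shift x d α β
    have e2 := hahnW_shift2 x d α β
    simp only [hP, Nat.add_sub_cancel, if_neg (Nat.succ_ne_zero x)]
    push_cast
    rw [show ((x : ℝ) + 1 - 1) = x by ring]
    linear_combination (hahnQ n (x + 1) α β (x + d + 1) - hahnQ n x α β (x + d + 1)) * (e2 - e1)

lemma hahnQ_zero (x α β : ℝ) (m : ℕ) : hahnQ 0 x α β m = 1 := by
  simp [hahnQ, poch_zero]

lemma hahn_orth0 (n : ℕ) (α β : ℝ) (m : ℕ) (hn : n + 1 ≤ m) (hα : -1 < α) (hs : 0 < α + β + 1) :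
    ∑ x ∈ Finset.range (m + 1), hahnW x α β m * hahnQ (n + 1) x α β m = 0 := by
  obtain ⟨m, rfl⟩ : ∃ k, m = k + 1 := ⟨m - 1, by omega⟩
  have h := hahn_step (n + 1) α β m hn hα (fun _ => 1)
  simp only [sub_self, mul_zero, Finset.sum_const_zero, mul_one] at h
  have hn0 : (0 : ℝ) ≤ n := by positivity
  rcases mul_eq_zero.mp h with h | h
  · exfalso
    have : 0 < ((n + 1 : ℕ) : ℝ) * (((n + 1 : ℕ) : ℝ) + α + β + 1) := by
      push_cast
      apply mul_pos <;> linarith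
    linarith
  · exact h

lemma hahn_orth (n : ℕ) : ∀ (n' : ℕ) (α β : ℝ) (m : ℕ), n ≤ m → n' ≤ m → -1 < α → -1 < β →
    0 < α + β + 1 →
    ∑ x ∈ Finset.range (m + 1), hahnW x α β m * hahnQ n x α β m * hahnQ n' x α β m =
      if n = n' then hahnH n α β m else 0 := by
  induction n with
  | zero =>
    intro n' α β m _ hn' hα hβ hs
    simp only [hahnQ_zero, mul_one]
    rcases n' with _ | n'
    · simp only [hahnQ_zero, mul_one, if_true]
      unfold hahnW hahnH
      rw [vander, poch_succ']
      simp only [poch_zero, Nat.cast_zero, pow_zero, Nat.factorial_zero, Nat.cast_one]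
      have h3 : (m.factorial : ℝ) ≠ 0 := by positivity
      have h4 : α + β + 1 ≠ 0 := hs.ne'
      rw [show α + 1 + (β + 1) = α + β + 1 + 1 by ring]
      rw [show (0 : ℝ) + α + β + 1 = α + β + 1 by ring, show 2 * (0 : ℝ) + α + β + 1 = α + β + 1 by ring]
      field_simp
    · rw [if_neg (by omega)]
      exact hahn_orth0 n' α β m hn' hα hs
  | succ n ih =>
    intro n' α β m hn hn' hα hβ hs
    rcases n' with _ | n'
    · simp only [hahnQ_zero, mul_one]
      rw [if_neg (by omega)]
      exact hahn_orth0 n α β m hn hα hs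
    · obtain ⟨m, rfl⟩ : ∃ k, m = k + 1 := ⟨m - 1, by omega⟩
      have hst := hahn_step (n + 1) α β m hn hα (fun x => hahnQ (n' + 1) x α β (m + 1))
      have i := ih n' (α + 1) (β + 1) m (by omega) (by omega) (by linarith) (by linarith) (by linarith)
      have hn0 : (0 : ℝ) ≤ n := by positivity
      have hl : ((n + 1 : ℕ) : ℝ) * (((n + 1 : ℕ) : ℝ) + α + β + 1) ≠ 0 := by
        push_cast
        apply ne_of_gt
        apply mul_pos <;> linarith
      have hα1 : α + 1 ≠ 0 := by intro h; linarith
      have h5 : (m : ℝ) + 1 ≠ 0 := by positivity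
      apply mul_left_cancel₀ hl
      rw [hst]
      have e : ∀ x ∈ Finset.range (m + 1), (α + 1) * (β + 1) * hahnW x (α + 1) (β + 1) m *
          (hahnQ (n + 1) ((x : ℝ) + 1) α β (m + 1) - hahnQ (n + 1) x α β (m + 1)) *
          (hahnQ (n' + 1) ((x + 1 : ℕ) : ℝ) α β (m + 1) - hahnQ (n' + 1) x α β (m + 1)) =
          ((α + 1) * (β + 1) * (-((n + 1) * (n + α + β + 2)) / ((α + 1) * (m + 1))) *
            (-((n' + 1) * (n' + α + β + 2)) / ((α + 1) * (m + 1)))) *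
          (hahnW x (α + 1) (β + 1) m * hahnQ n x (α + 1) (β + 1) m * hahnQ n' x (α + 1) (β + 1) m) := by
        intro x _
        push_cast
        rw [hahnQ_fwd _ _ _ _ _ (by omega) hα, hahnQ_fwd _ _ _ _ _ (by omega) hα]
        ring
      rw [Finset.sum_congr rfl e, ← Finset.mul_sum, i]
      by_cases hnn : n = n'
      · subst hnn
        simp only [if_true]
        rw [hahnH_rec _ _ _ _ (by omega) hα hs]
        push_cast
        field_simp
        ring
      · rw [if_neg hnn, if_neg (by omega)]
        simp

lemma sqrt_swap {A w w' b c : ℝ} (hA : 0 ≤ A) (hw : 0 ≤ w) (hb : 0 ≤ b)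
    (h : A * w' = w * (b ^ 2 * c)) :
    Real.sqrt A * Real.sqrt w' = Real.sqrt w * (b * Real.sqrt c) := by
  rw [← Real.sqrt_mul hA, h, Real.sqrt_mul hw, Real.sqrt_mul (sq_nonneg b), Real.sqrt_sq hb]

lemma hahnH_sqrt (n : ℕ) (α β : ℝ) (m : ℕ) (hn : n ≤ m) (hα : -1 < α) (hβ : 0 < β) :
    Real.sqrt ((α + n + 1) * (β + n)) * Real.sqrt (hahnH n (α + 1) (β - 1) m) =
      Real.sqrt (hahnH n α β m) * ((α + 1) * Real.sqrt (β / (α + 1))) := by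
  have hn0 : (0 : ℝ) ≤ n := by positivity
  have hα1 : α + 1 ≠ 0 := by intro h; linarith
  apply sqrt_swap
  · apply mul_nonneg <;> linarith
  · exact (hahnH_pos n α β m hn hα (by linarith) (by linarith)).le
  · linarith
  · have := hahnH_shift n α β m hn hα (by linarith)
    field_simp
    linear_combination this

/-- the diagonal coupling acting on the primed weight. -/
lemma sqW_diag (i : ℕ) (α β : ℝ) (m : ℕ) (hi : i ≤ m) (hα : -1 < α) (hβ : 0 < β) :
    Real.sqrt ((i + α + 1) * (m + β - i)) * Real.sqrt (hahnW i (α + 1) (β - 1) m) =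
      Real.sqrt (hahnW i α β m) * ((i + α + 1) * Real.sqrt (β / (α + 1))) := by
  obtain ⟨d, rfl⟩ := Nat.exists_eq_add_of_le hi
  have hα1 : α + 1 ≠ 0 := by intro h; linarith
  have hi0 : (0 : ℝ) ≤ i := by positivity
  have hd0 : (0 : ℝ) ≤ d := by positivity
  have h := hahnW_odd i d α β
  push_cast
  apply sqrt_swap
  · apply mul_nonneg <;> linarith
  · exact (hahnW_pos i α β _ hα (by linarith)).le
  · linarith
  · field_simp
    linear_combination (i + α + 1) * h

lemma sqW_diag' (i : ℕ) (α β : ℝ) (m : ℕ) (hi : i ≤ m) (hα : -1 < α) (hβ : 0 < β) :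
    Real.sqrt ((i + α + 1) * (m + β - i)) * Real.sqrt (hahnW i α β m) =
      Real.sqrt (hahnW i (α + 1) (β - 1) m) * ((m + β - i) * Real.sqrt ((α + 1) / β)) := by
  obtain ⟨d, rfl⟩ := Nat.exists_eq_add_of_le hi
  have hi0 : (0 : ℝ) ≤ i := by positivity
  have hd0 : (0 : ℝ) ≤ d := by positivity
  have h := hahnW_odd i d α β
  push_cast
  apply sqrt_swap
  · apply mul_nonneg <;> linarith
  · exact (hahnW_pos i (α + 1) (β - 1) _ (by linarith) (by linarith)).le
  · linarith
  · field_simp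
    linear_combination (-(d + β)) * h

lemma sqW_off (i : ℕ) (α β : ℝ) (m : ℕ) (hi : i + 1 ≤ m) (hα : -1 < α) (hβ : 0 < β) :
    Real.sqrt ((i + 1) * (m - i)) * Real.sqrt (hahnW i (α + 1) (β - 1) m) =
      Real.sqrt (hahnW (i + 1) α β m) * ((i + 1) * Real.sqrt (β / (α + 1))) := by
  obtain ⟨d, rfl⟩ := Nat.exists_eq_add_of_le hi
  have hα1 : α + 1 ≠ 0 := by intro h; linarith
  have hi0 : (0 : ℝ) ≤ i := by positivity
  have hd0 : (0 : ℝ) ≤ d := by positivity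
  have h := hahnW_even i d α β
  push_cast
  apply sqrt_swap
  · apply mul_nonneg <;> linarith
  · exact (hahnW_pos _ α β _ hα (by linarith)).le
  · linarith
  · field_simp
    linear_combination h

lemma sqW_off' (i : ℕ) (α β : ℝ) (m : ℕ) (hi : i + 1 ≤ m) (hα : -1 < α) (hβ : 0 < β) :
    Real.sqrt ((i + 1) * (m - i)) * Real.sqrt (hahnW (i + 1) α β m) =
      Real.sqrt (hahnW i (α + 1) (β - 1) m) * ((m - i) * Real.sqrt ((α + 1) / β)) := by
  obtain ⟨d, rfl⟩ := Nat.exists_eq_add_of_le hi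
  have hi0 : (0 : ℝ) ≤ i := by positivity
  have hd0 : (0 : ℝ) ≤ d := by positivity
  have h := hahnW_even i d α β
  push_cast
  apply sqrt_swap
  · apply mul_nonneg <;> linarith
  · exact (hahnW_pos _ (α + 1) (β - 1) _ (by linarith) (by linarith)).le
  · linarith
  · field_simp
    linear_combination (-(d + 1)) * h

lemma Qt_even_aux (n : ℕ) (x α β : ℝ) (m : ℕ) (hn : n ≤ m) (hα : -1 < α) (hβ : 0 < β) (s : ℝ) :
    s * Real.sqrt (β / (α + 1)) * ((x + α + 1) * hahnQ n x (α + 1) (β - 1) m -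
      x * hahnQ n (x - 1) (α + 1) (β - 1) m) / Real.sqrt (hahnH n (α + 1) (β - 1) m) =
    Real.sqrt ((α + n + 1) * (β + n)) * (s * hahnQ n x α β m / Real.sqrt (hahnH n α β m)) := by
  rw [hahnQ_even _ _ _ _ _ hα]
  have h := hahnH_sqrt n α β m hn hα hβ
  have h1 := Real.sqrt_pos.mpr (hahnH_pos n α β m hn hα (by linarith) (by linarith))
  have h2 := Real.sqrt_pos.mpr (hahnH_pos n (α + 1) (β - 1) m hn (by linarith) (by linarith) (by linarith))
  generalize Real.sqrt (hahnH n (α + 1) (β - 1) m) = H' at *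
  generalize Real.sqrt (hahnH n α β m) = H at *
  generalize Real.sqrt ((α + n + 1) * (β + n)) = E at *
  generalize Real.sqrt (β / (α + 1)) = K at *
  rw [mul_div_assoc', div_eq_div_iff h2.ne' h1.ne']
  linear_combination (-s * hahnQ n x α β m) * h

lemma Qt_even0 (n : ℕ) (α β : ℝ) (m : ℕ) (hn : n ≤ m) (hα : -1 < α) (hβ : 0 < β) :
    Real.sqrt (((0 : ℕ) + α + 1) * (m + β - (0 : ℕ))) * hahnQt n 0 (α + 1) (β - 1) m =
      Real.sqrt ((α + n + 1) * (β + n)) * hahnQt n 0 α β m := by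
  have h := Qt_even_aux n 0 α β m hn hα hβ (Real.sqrt (hahnW 0 α β m))
  have h1 := sqW_diag 0 α β m (by omega) hα hβ
  unfold hahnQt
  simp only [Nat.cast_zero] at *
  rw [← h, ← mul_div_assoc, ← mul_assoc, h1]
  ring

lemma Qt_even (n i : ℕ) (α β : ℝ) (m : ℕ) (hn : n ≤ m) (hi : i + 1 ≤ m) (hα : -1 < α) (hβ : 0 < β) :
    Real.sqrt (((i + 1 : ℕ) + α + 1) * (m + β - (i + 1 : ℕ))) * hahnQt n (i + 1) (α + 1) (β - 1) m -
    Real.sqrt ((i + 1) * (m - i)) * hahnQt n i (α + 1) (β - 1) m =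
      Real.sqrt ((α + n + 1) * (β + n)) * hahnQt n (i + 1) α β m := by
  have h := Qt_even_aux n (i + 1 : ℕ) α β m hn hα hβ (Real.sqrt (hahnW (i + 1) α β m))
  have h1 := sqW_diag (i + 1) α β m (by omega) hα hβ
  have h2 := sqW_off i α β m hi hα hβ
  unfold hahnQt
  rw [← h, ← mul_div_assoc, ← mul_assoc, h1, ← mul_div_assoc, ← mul_assoc (Real.sqrt ((i + 1) * (m - i))), h2]
  rw [show (((i + 1 : ℕ) : ℝ) - 1) = i by push_cast; ring]
  push_cast
  ring

lemma Qt_odd (n i : ℕ) (α β : ℝ) (m : ℕ) (hn : n ≤ m) (hi : i ≤ m) (hα : -1 < α) (hβ : 0 < β) :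
    Real.sqrt ((i + α + 1) * (m + β - i)) * hahnQt n i α β m -
    Real.sqrt ((i + 1) * (m - i)) * hahnQt n (i + 1) α β m =
      Real.sqrt ((α + n + 1) * (β + n)) * hahnQt n i (α + 1) (β - 1) m := by
  have hα1 : 0 < α + 1 := by linarith
  have hn0 : (0 : ℝ) ≤ n := by positivity
  have h1 := sqW_diag' i α β m hi hα hβ
  have h2 : Real.sqrt ((i + 1) * (m - i)) * Real.sqrt (hahnW (i + 1) α β m) =
      Real.sqrt (hahnW i (α + 1) (β - 1) m) * ((m - i) * Real.sqrt ((α + 1) / β)) := by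
    rcases Nat.lt_or_ge i m with h | h
    · exact sqW_off' i α β m h hα hβ
    · obtain rfl : i = m := by omega
      simp
  have h3 := hahnQ_odd n i α β m hn hα
  have h := hahnH_sqrt n α β m hn hα hβ
  have p1 := Real.sqrt_pos.mpr (hahnH_pos n α β m hn hα (by linarith) (by linarith))
  have p2 := Real.sqrt_pos.mpr (hahnH_pos n (α + 1) (β - 1) m hn (by linarith) (by linarith) (by linarith))
  have hK : Real.sqrt ((α + 1) / β) * Real.sqrt (β / (α + 1)) = 1 := by
    rw [← Real.sqrt_mul (by positivity)]
    rw [show (α + 1) / β * (β / (α + 1)) = 1 by field_simp]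
    simp
  have hE : Real.sqrt ((α + n + 1) * (β + n)) * Real.sqrt ((α + n + 1) * (β + n)) =
      (α + n + 1) * (β + n) := Real.mul_self_sqrt (by apply mul_nonneg <;> linarith)
  unfold hahnQt
  rw [← mul_div_assoc, ← mul_assoc, h1, ← mul_div_assoc, ← mul_assoc (Real.sqrt ((i + 1) * (m - i))), h2]
  push_cast
  generalize Real.sqrt (hahnH n (α + 1) (β - 1) m) = H' at *
  generalize Real.sqrt (hahnH n α β m) = H at *
  generalize Real.sqrt ((α + n + 1) * (β + n)) = E at *
  generalize Real.sqrt (β / (α + 1)) = K at *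
  generalize Real.sqrt ((α + 1) / β) = K' at *
  generalize Real.sqrt (hahnW i (α + 1) (β - 1) m) = w at *
  have e : (w * ((m + β - i) * K') * hahnQ n i α β m / H - w * ((m - i) * K') * hahnQ n (i + 1) α β m / H) =
    w * K' * ((m + β - i) * hahnQ n i α β m - (m - i) * hahnQ n (i + 1) α β m) / H := by ring
  rw [e, h3, mul_div_assoc', div_eq_div_iff p1.ne' p2.ne']
  generalize hahnQ n i (α + 1) (β - 1) m = Q
  have e2 : K' * E * H' = H * (α + 1) := by
    linear_combination K' * h + H * (α + 1) * hK
  have e3 : (β + n) * (α + 1 + n) / (α + 1) = E * E / (α + 1) := by rw [hE]; ring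
  rw [e3]
  field_simp
  linear_combination w * E * Q * e2

lemma Qt_orth (n n' : ℕ) (α β : ℝ) (m : ℕ) (hn : n ≤ m) (hn' : n' ≤ m) (hα : -1 < α) (hβ : -1 < β)
    (hs : 0 < α + β + 1) :
    ∑ x ∈ Finset.range (m + 1), hahnQt n x α β m * hahnQt n' x α β m = if n = n' then 1 else 0 := by
  have h := hahn_orth n n' α β m hn hn' hα hβ hs
  have p1 := hahnH_pos n α β m hn hα hβ hs
  have e : ∀ x ∈ Finset.range (m + 1), hahnQt n x α β m * hahnQt n' x α β m =
      (1 / (Real.sqrt (hahnH n α β m) * Real.sqrt (hahnH n' α β m))) *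
      (hahnW x α β m * hahnQ n x α β m * hahnQ n' x α β m) := by
    intro x _
    have := Real.mul_self_sqrt (hahnW_pos x α β m hα hβ).le
    unfold hahnQt
    nth_rw 3 [← this]
    ring
  rw [Finset.sum_congr rfl e, ← Finset.mul_sum, h]
  by_cases hnn : n = n'
  · subst hnn
    simp only [if_true]
    rw [Real.mul_self_sqrt p1.le]
    field_simp
  · simp [hnn]

lemma hahnJ_even (α β : ℝ) (m i : ℕ) :
    hahnJ α β m (2 * i) = 2 * Real.sqrt ((i + α + 1) * (m + β - i)) := by
  unfold hahnJ
  rw [if_neg (by omega)]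
  push_cast
  rw [show (2 * (i : ℝ) + 2 * α + 2) * (2 * m + 2 * β - 2 * i) = 2 ^ 2 * ((i + α + 1) * (m + β - i)) by ring,
    Real.sqrt_mul (by norm_num), Real.sqrt_sq (by norm_num)]

lemma hahnJ_odd (α β : ℝ) (m i : ℕ) :
    hahnJ α β m (2 * i + 1) = 2 * Real.sqrt ((i + 1) * (m - i)) := by
  unfold hahnJ
  rw [if_pos (by omega)]
  push_cast
  rw [show (2 * (i : ℝ) + 1 + 1) * (2 * m + 1 - (2 * i + 1)) = 2 ^ 2 * ((i + 1) * (m - i)) by ring,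
    Real.sqrt_mul (by norm_num), Real.sqrt_sq (by norm_num)]

lemma hahnM_row (α β : ℝ) (m : ℕ) (r : Fin (2 * m + 2)) (u : ℕ → ℝ) :
    ∑ k : Fin (2 * m + 2), hahnM α β m r k * u k =
      (if (r : ℕ) = 0 then 0 else hahnJ α β m (r - 1) * u (r - 1)) + hahnJ α β m r * u (r + 1) := by
  have h1 : ∑ k : Fin (2 * m + 2), hahnM α β m r k * u k =
      ∑ k ∈ Finset.range (2 * m + 2), ((if (k + 1 = (r : ℕ)) then hahnJ α β m k * u k else 0) +
        (if (r : ℕ) + 1 = k then hahnJ α β m r * u k else 0)) := by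
    rw [← Fin.sum_univ_eq_sum_range (fun k => ((if (k + 1 = (r : ℕ)) then hahnJ α β m k * u k else 0) +
        (if (r : ℕ) + 1 = k then hahnJ α β m r * u k else 0)))]
    apply Finset.sum_congr rfl
    intro k _
    simp only [hahnM, Matrix.of_apply]
    by_cases h1 : (r : ℕ) + 1 = k
    · rw [if_pos h1, if_pos h1, if_neg (by omega)]; ring
    · rw [if_neg h1, if_neg h1]
      split_ifs <;> ring
  rw [h1, Finset.sum_add_distrib]
  obtain ⟨r, hr⟩ := r
  simp only
  congr 1
  · rcases r with _ | r
    · simp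
    · simp only [Nat.add_right_cancel_iff, Finset.sum_ite_eq', Finset.mem_range]
      rw [if_pos (by omega), if_neg (by omega)]
      simp
  · rw [Finset.sum_ite_eq]
    split_ifs with h
    · rfl
    · have : r = 2 * m + 1 := by rw [Finset.mem_range] at h; omega
      subst this
      rw [hahnJ_odd]
      simp

/-- column profile on natural indices -/
noncomputable def colU (A B : ℕ → ℝ) (σ : ℝ) (k : ℕ) : ℝ :=
  if k % 2 = 0 then ((-1 : ℝ) ^ (k / 2) / Real.sqrt 2) * A (k / 2)
  else σ * ((-1 : ℝ) ^ (k / 2) / Real.sqrt 2) * B (k / 2)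

lemma colU_even (A B : ℕ → ℝ) (σ : ℝ) (i : ℕ) :
    colU A B σ (2 * i) = ((-1 : ℝ) ^ i / Real.sqrt 2) * A i := by
  unfold colU
  rw [if_pos (by omega), show 2 * i / 2 = i by omega]

lemma colU_odd (A B : ℕ → ℝ) (σ : ℝ) (i : ℕ) :
    colU A B σ (2 * i + 1) = σ * ((-1 : ℝ) ^ i / Real.sqrt 2) * B i := by
  unfold colU
  rw [if_neg (by omega), show (2 * i + 1) / 2 = i by omega]

lemma col_eq (α β : ℝ) (m : ℕ) (c : Fin (2 * m + 2)) : ∃ (j : ℕ) (σ : ℝ), j ≤ m ∧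
    ((σ = -1 ∧ (c : ℕ) = m - j) ∨ (σ = 1 ∧ (c : ℕ) = m + j + 1)) ∧
    hahnEps α β m c = σ * (2 * Real.sqrt ((α + j + 1) * (β + j))) ∧
    ∀ r : Fin (2 * m + 2), hahnU α β m r c =
      colU (fun i => hahnQt j i α β m) (fun i => hahnQt j i (α + 1) (β - 1) m) σ r := by
  have hc := c.2
  by_cases h : (c : ℕ) ≤ m
  · refine ⟨m - c, -1, by omega, Or.inl ⟨rfl, by omega⟩, ?_, ?_⟩
    · unfold hahnEps
      rw [if_pos h]
      ring
    · intro r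
      simp only [hahnU, Matrix.of_apply, colU, if_pos h]
  · refine ⟨c - m - 1, 1, by omega, Or.inr ⟨rfl, by omega⟩, ?_, ?_⟩
    · unfold hahnEps
      rw [if_neg h]
      ring
    · intro r
      simp only [hahnU, Matrix.of_apply, colU, if_neg h]

lemma sum_pairs (f : ℕ → ℝ) (n : ℕ) :
    ∑ k ∈ Finset.range (2 * n), f k = ∑ i ∈ Finset.range n, (f (2 * i) + f (2 * i + 1)) := by
  induction n with
  | zero => simp
  | succ n ih =>
    rw [show 2 * (n + 1) = 2 * n + 1 + 1 by ring, Finset.sum_range_succ, Finset.sum_range_succ, ih,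
      Finset.sum_range_succ]
    ring

theorem hahn_spin_chain_diagonalization (m : ℕ) (α β : ℝ) (hα : α > -1) (hβ : β > 0) :
    hahnM α β m * hahnU α β m = hahnU α β m * Matrix.diagonal (hahnEps α β m) ∧
    (hahnU α β m)ᵀ * hahnU α β m = 1 ∧ hahnU α β m * (hahnU α β m)ᵀ = 1 := by
  have horth : (hahnU α β m)ᵀ * hahnU α β m = 1 := by
    ext c c'
    rw [Matrix.mul_apply, Matrix.one_apply]
    simp only [Matrix.transpose_apply]
    obtain ⟨j, σ, hj, hσ, -, hU⟩ := col_eq α β m c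
    obtain ⟨j', σ', hj', hσ', -, hU'⟩ := col_eq α β m c'
    simp only [hU, hU']
    rw [Fin.sum_univ_eq_sum_range (fun k =>
      colU (fun i => hahnQt j i α β m) (fun i => hahnQt j i (α + 1) (β - 1) m) σ k *
      colU (fun i => hahnQt j' i α β m) (fun i => hahnQt j' i (α + 1) (β - 1) m) σ' k),
      show Finset.range (2 * m + 2) = Finset.range (2 * (m + 1)) from rfl, sum_pairs]
    have e : ∀ i ∈ Finset.range (m + 1),
      (colU (fun i => hahnQt j i α β m) (fun i => hahnQt j i (α + 1) (β - 1) m) σ (2 * i) *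
      colU (fun i => hahnQt j' i α β m) (fun i => hahnQt j' i (α + 1) (β - 1) m) σ' (2 * i) +
      colU (fun i => hahnQt j i α β m) (fun i => hahnQt j i (α + 1) (β - 1) m) σ (2 * i + 1) *
      colU (fun i => hahnQt j' i α β m) (fun i => hahnQt j' i (α + 1) (β - 1) m) σ' (2 * i + 1)) =
      (1 / 2) * (hahnQt j i α β m * hahnQt j' i α β m) +
      (σ * σ' / 2) * (hahnQt j i (α + 1) (β - 1) m * hahnQt j' i (α + 1) (β - 1) m) := by
      intro i _
      simp only [colU_even, colU_odd]
      have h : ((-1 : ℝ) ^ i / Real.sqrt 2) * ((-1 : ℝ) ^ i / Real.sqrt 2) = 1 / 2 := by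
        rw [div_mul_div_comm, Real.mul_self_sqrt (by norm_num), ← mul_pow]
        norm_num
      linear_combination ((hahnQt j i α β m * hahnQt j' i α β m) +
        σ * σ' * (hahnQt j i (α + 1) (β - 1) m * hahnQt j' i (α + 1) (β - 1) m)) * h
    rw [Finset.sum_congr rfl e, Finset.sum_add_distrib, ← Finset.mul_sum, ← Finset.mul_sum,
      Qt_orth _ _ _ _ _ hj hj' hα (by linarith) (by linarith),
      Qt_orth _ _ _ _ _ hj hj' (by linarith) (by linarith) (by linarith)]
    by_cases hjj : j = j'
    · subst hjj
      rcases hσ with ⟨rfl, h1⟩ | ⟨rfl, h1⟩ <;> rcases hσ' with ⟨rfl, h2⟩ | ⟨rfl, h2⟩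
      · rw [if_pos (Fin.ext (by omega))]; norm_num
      · rw [if_neg (fun h : c = c' => by have := congrArg Fin.val h; omega)]; norm_num
      · rw [if_neg (fun h : c = c' => by have := congrArg Fin.val h; omega)]; norm_num
      · rw [if_pos (Fin.ext (by omega))]; norm_num
    · have : c ≠ c' := by
        intro h
        have := congrArg Fin.val h
        rcases hσ with ⟨-, h1⟩ | ⟨-, h1⟩ <;> rcases hσ' with ⟨-, h2⟩ | ⟨-, h2⟩ <;> omega
      simp [hjj, this]
  refine ⟨?_, horth, mul_eq_one_comm.mp horth⟩
  ext r c
  rw [Matrix.mul_apply, Matrix.mul_diagonal]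
  obtain ⟨j, σ, hj, hσ, hE, hU⟩ := col_eq α β m c
  have hσ2 : σ * σ = 1 := by
    rcases hσ with ⟨rfl, -⟩ | ⟨rfl, -⟩ <;> norm_num
  simp only [hU, hE]
  rw [hahnM_row]
  obtain ⟨r, hr⟩ := r
  simp only
  rcases Nat.even_or_odd' r with ⟨i, rfl | rfl⟩
  · rcases i with _ | i
    · have h := Qt_even0 j α β m hj hα hβ
      have e1 := colU_even (fun i => hahnQt j i α β m) (fun i => hahnQt j i (α + 1) (β - 1) m) σ 0
      have e2 := colU_odd (fun i => hahnQt j i α β m) (fun i => hahnQt j i (α + 1) (β - 1) m) σ 0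
      rw [hahnJ_even, e1, e2, if_pos (by omega)]
      linear_combination 2 * σ * ((-1 : ℝ) ^ 0 / Real.sqrt 2) * h
    · have h := Qt_even j i α β m hj (by omega) hα hβ
      rw [hahnJ_even, colU_even, colU_odd, if_neg (by omega), show 2 * (i + 1) - 1 = 2 * i + 1 by omega,
        hahnJ_odd, colU_odd, pow_succ]
      linear_combination -2 * σ * ((-1 : ℝ) ^ i / Real.sqrt 2) * h
  · have h := Qt_odd j i α β m hj (by omega) hα hβ
    rw [if_neg (by omega), Nat.add_sub_cancel, hahnJ_even, hahnJ_odd, colU_even, colU_odd,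
      show 2 * i + 1 + 1 = 2 * (i + 1) by ring, colU_even, pow_succ]
    linear_combination 2 * ((-1 : ℝ) ^ i / Real.sqrt 2) * h -
      2 * ((-1 : ℝ) ^ i / Real.sqrt 2) * Real.sqrt ((α + j + 1) * (β + j)) * hahnQt j i (α + 1) (β - 1) m * hσ2
end

section
/- Let 0 < q < 1, 0 < α < q^{-1}, 0 < β < 1, N = 2m+1, and let M_q be the (N+1)×(N+1) symmetric tridiagonal matrix with zero diagonal and J_{2k+1} = 2√((1-q^{k+1})(1-q^{m-k})q^{k+1}α), J_{2k} = 2√((1-αq^{k+1})(1-βq^{m-k})q^k). Then the eigenvalues of M_q are ±2√((1-αq^{k+1})(1-βq^k)q^{m-k}) for k = 0,…,m, with eigenvectors given by the columns of the orthogonal matrix U whose entries are U_{2i,m-j} = U_{2i,m+j+1} = ((-1)^i/√2)Q̃_j(q^{-i};α,β,m|q) and U_{2i+1,m-j} = -U_{2i+1,m+j+1} = -((-1)^i/√2)Q̃_j(q^{-i};αq,βq^{-1},m|q). -/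
open Finset Matrix

/-- The q-shifted factorial `(a;q)_k = (1-a)(1-aq)⋯(1-aq^{k-1})`. -/
noncomputable def qpoch (a q : ℝ) (k : ℕ) : ℝ := ∏ i ∈ Finset.range k, (1 - a * q ^ i)

/-- The q-Hahn polynomial `Q_n(q^{-x};α,β,m|q)` as a terminating ₃Φ₂ series. -/
noncomputable def qhahnQ (n x : ℕ) (α β : ℝ) (m : ℕ) (q : ℝ) : ℝ :=
  ∑ k ∈ Finset.range (n + 1),
    qpoch (q ^ (-(n : ℤ))) q k * qpoch (α * β * q ^ (n + 1)) q k
        * qpoch (q ^ (-(x : ℤ))) q k /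
      (qpoch q q k * qpoch (α * q) q k * qpoch (q ^ (-(m : ℤ))) q k) * q ^ k

/-- The q-Hahn weight `w(x;α,β,m|q)`. -/
noncomputable def qhahnW (x : ℕ) (α β : ℝ) (m : ℕ) (q : ℝ) : ℝ :=
  qpoch (α * q) q x * qpoch (q ^ (-(m : ℤ))) q x /
    (qpoch q q x * qpoch (q ^ (-(m : ℤ)) / β) q x) * (α * β * q) ^ (-(x : ℤ))

/-- The squared norm `h_n(α,β,m|q)` of the q-Hahn polynomials. -/
noncomputable def qhahnH (n : ℕ) (α β : ℝ) (m : ℕ) (q : ℝ) : ℝ :=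
  qpoch (α * β * q ^ 2) q m * qpoch q q n * qpoch (α * β * q ^ (m + 2)) q n
      * qpoch (β * q) q n * (1 - α * β * q) * (-(α * q)) ^ n /
    (qpoch (β * q) q m * (α * q) ^ m * qpoch (α * q) q n * qpoch (α * β * q) q n
        * qpoch (q ^ (-(m : ℤ))) q n * (1 - α * β * q ^ (2 * n + 1)))
    * q ^ ((n.choose 2 : ℤ) - (m : ℤ) * n)

/-- Orthonormal q-Hahn function `Q̃_n(q^{-x};α,β,m|q)`. -/
noncomputable def qhahnQt (n x : ℕ) (α β : ℝ) (m : ℕ) (q : ℝ) : ℝ :=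
  Real.sqrt (qhahnW x α β m q) * qhahnQ n x α β m q / Real.sqrt (qhahnH n α β m q)

/-- The matrix `U` of eigenvectors in the q-Hahn model, built from q-Hahn polynomials
with parameters `(α,β)` (even rows) and `(αq,βq⁻¹)` (odd rows). -/
noncomputable def qhahnU (α β : ℝ) (m : ℕ) (q : ℝ) :
    Matrix (Fin (2 * m + 2)) (Fin (2 * m + 2)) ℝ :=
  Matrix.of fun r c =>
    let i : ℕ := (r : ℕ) / 2
    let j : ℕ := if (c : ℕ) ≤ m then m - (c : ℕ) else (c : ℕ) - m - 1
    if (r : ℕ) % 2 = 0 then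
      ((-1 : ℝ) ^ i / Real.sqrt 2) * qhahnQt j i α β m q
    else
      (if (c : ℕ) ≤ m then (-1 : ℝ) else 1) * ((-1 : ℝ) ^ i / Real.sqrt 2)
        * qhahnQt j i (α * q) (β / q) m q

/-- The q-deformed couplings: `J_{2k+1} = 2√((1-q^{k+1})(1-q^{m-k})q^{k+1}α)`,
`J_{2k} = 2√((1-αq^{k+1})(1-βq^{m-k})q^k)`. -/
noncomputable def qhahnJ (α β : ℝ) (m : ℕ) (q : ℝ) (r : ℕ) : ℝ :=
  if r % 2 = 0 then
    2 * Real.sqrt ((1 - α * q ^ (r / 2 + 1)) * (1 - β * q ^ (m - r / 2)) * q ^ (r / 2))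
  else
    2 * Real.sqrt ((1 - q ^ (r / 2 + 1)) * (1 - q ^ (m - r / 2)) * q ^ (r / 2 + 1) * α)

/-- The tridiagonal interaction matrix `M_q`. -/
noncomputable def qhahnM (α β : ℝ) (m : ℕ) (q : ℝ) :
    Matrix (Fin (2 * m + 2)) (Fin (2 * m + 2)) ℝ :=
  Matrix.of fun r c =>
    if (r : ℕ) + 1 = (c : ℕ) then qhahnJ α β m q r
    else if (c : ℕ) + 1 = (r : ℕ) then qhahnJ α β m q c
    else 0

/-- The eigenvalues `ε_{m-k} = -2√((1-αq^{k+1})(1-βq^k)q^{m-k})`,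
`ε_{m+k+1} = +2√((1-αq^{k+1})(1-βq^k)q^{m-k})`. -/
noncomputable def qhahnEps (α β : ℝ) (m : ℕ) (q : ℝ) (c : Fin (2 * m + 2)) : ℝ :=
  if (c : ℕ) ≤ m then
    -2 * Real.sqrt ((1 - α * q ^ ((m - (c : ℕ)) + 1)) * (1 - β * q ^ (m - (c : ℕ)))
        * q ^ (m - (m - (c : ℕ))))
  else
    2 * Real.sqrt ((1 - α * q ^ (((c : ℕ) - m - 1) + 1)) * (1 - β * q ^ ((c : ℕ) - m - 1))
        * q ^ (m - ((c : ℕ) - m - 1)))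


lemma qpoch_zero (a q : ℝ) : qpoch a q 0 = 1 := by simp [qpoch]

lemma qpoch_succ (a q : ℝ) (k : ℕ) : qpoch a q (k+1) = qpoch a q k * (1 - a * q^k) := by
  simp [qpoch, Finset.prod_range_succ]

lemma qpoch_succ' (a q : ℝ) (k : ℕ) : qpoch a q (k+1) = (1 - a) * qpoch (a * q) q k := by
  simp only [qpoch, Finset.prod_range_succ']
  rw [mul_comm]
  congr 1
  · simp
  · refine Finset.prod_congr rfl fun i _ => ?_
    ring

lemma qpoch_shift (a q : ℝ) (k : ℕ) :
    (1 - a) * qpoch (a * q) q k = qpoch a q k * (1 - a * q^k) := by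
  rw [← qpoch_succ, ← qpoch_succ']

lemma qpoch_pos {a q : ℝ} (hq0 : 0 < q) (hq1 : q < 1) (ha0 : 0 < a) (ha : a < 1) (k : ℕ) :
    0 < qpoch a q k := by
  refine Finset.prod_pos fun i _ => ?_
  have h1 : q^i ≤ 1 := pow_le_one₀ hq0.le hq1.le
  have h2 : 0 < q^i := by positivity
  nlinarith

lemma qpoch_neg_ne {q : ℝ} (hq0 : 0 < q) (hq1 : q < 1) {m k : ℕ} (h : k ≤ m) :
    qpoch ((q^m)⁻¹) q k ≠ 0 := by
  refine Finset.prod_ne_zero_iff.2 fun i hi => ?_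
  have hi : i < m := lt_of_lt_of_le (Finset.mem_range.1 hi) h
  have h3 : q^m < q^i := pow_lt_pow_right_of_lt_one₀ hq0 hq1 hi
  have h2 : 0 < q^m := by positivity
  have : 1 < (q^m)⁻¹ * q^i := by
    rw [inv_mul_eq_div, lt_div_iff₀ h2]; linarith
  linarith

/-- coefficients -/
noncomputable def qcf (n k : ℕ) (α β : ℝ) (m : ℕ) (q : ℝ) : ℝ :=
  qpoch ((q^n)⁻¹) q k * qpoch (α * β * q ^ (n + 1)) q k /
      (qpoch q q k * qpoch (α * q) q k * qpoch ((q^m)⁻¹) q k) * q ^ k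

/-- polynomial -/
noncomputable def qpol (n : ℕ) (X : ℝ) (α β : ℝ) (m : ℕ) (q : ℝ) : ℝ :=
  ∑ k ∈ Finset.range (n + 1), qcf n k α β m q * qpoch X q k

lemma qhahnQ_eq (n x : ℕ) (α β : ℝ) (m : ℕ) (q : ℝ) :
    qhahnQ n x α β m q = qpol n ((q^x)⁻¹) α β m q := by
  unfold qhahnQ qpol qcf
  simp only [_root_.zpow_neg, zpow_natCast]
  refine Finset.sum_congr rfl fun k _ => ?_
  ring

lemma qcf_prime (n k : ℕ) {α β : ℝ} (m : ℕ) {q : ℝ} (hq0 : 0 < q) (hq1 : q < 1)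
    (hα0 : 0 < α) (hα : α * q < 1) :
    qcf n k (α * q) (β / q) m q * (1 - α * q^(k+1)) = (1 - α * q) * qcf n k α β m q := by
  unfold qcf
  have h1 : α * q * (β / q) = α * β := by field_simp
  rw [h1]
  have h2 := (qpoch_pos hq0 hq1 (by positivity : 0 < α * q) hα k).ne'
  have h3 := (qpoch_pos hq0 hq1 (by positivity : 0 < α * q * q) (by nlinarith) k).ne'
  have h4 := qpoch_shift (α * q) q k
  have h4' : 1 - α * q ^ (k+1) = (1 - α * q) * qpoch (α * q * q) q k / qpoch (α * q) q k := by
    rw [h4]; field_simp; ring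
  rw [h4']
  by_cases h5 : qpoch ((q^m)⁻¹) q k = 0
  · simp [h5]
  · have h6 := (qpoch_pos hq0 hq1 hq0 hq1 k).ne'
    clear h4 h4'
    generalize qpoch (α * q * q) q k = A at *
    generalize qpoch ((q^m)⁻¹) q k = B at *
    field_simp

lemma R1_pol (n : ℕ) (X : ℝ) {α β : ℝ} (m : ℕ) {q : ℝ} (hq0 : 0 < q) (hq1 : q < 1)
    (hα0 : 0 < α) (hα : α * q < 1) :
    (X - α * q) * qpol n X (α * q) (β / q) m q
      + α * q * (1 - X) * qpol n (X * q) (α * q) (β / q) m q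
      = X * (1 - α * q) * qpol n X α β m q := by
  unfold qpol
  rw [Finset.mul_sum, Finset.mul_sum, Finset.mul_sum, ← Finset.sum_add_distrib]
  refine Finset.sum_congr rfl fun k _ => ?_
  have h1 := qpoch_shift X q k
  have h2 := qcf_prime n k (β := β) m hq0 hq1 hα0 hα
  linear_combination α * q * qcf n k (α * q) (β / q) m q * h1 + X * qpoch X q k * h2

lemma qcf_succ (n k : ℕ) {α β : ℝ} {m : ℕ} {q : ℝ} (hq0 : 0 < q) (hq1 : q < 1)
    (hα0 : 0 < α) (hα : α * q < 1) (hk : k + 1 ≤ m) :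
    qcf n (k+1) α β m q * ((1 - q^(k+1)) * (1 - α * q^(k+1)) * (1 - (q^m)⁻¹ * q^k))
      = qcf n k α β m q * ((1 - (q^n)⁻¹ * q^k) * (1 - α * β * q^(n+1) * q^k) * q) := by
  unfold qcf
  have h1 := (qpoch_pos hq0 hq1 hq0 hq1 (k+1)).ne'
  have h2 := (qpoch_pos hq0 hq1 (by positivity : 0 < α * q) hα (k+1)).ne'
  have h3 := qpoch_neg_ne hq0 hq1 hk
  simp only [qpoch_succ] at *
  have e1 : 1 - q^(k+1) = 1 - q * q^k := by ring
  have e2 : 1 - α * q^(k+1) = 1 - α * q * q^k := by ring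
  rw [e1, e2, pow_succ q k]
  generalize (q^m)⁻¹ = Z at *
  generalize (q^n)⁻¹ = Y at *
  generalize q^k = P at *
  generalize α * β * q^(n+1) = V at *
  have ⟨a1, b1⟩ := mul_ne_zero_iff.1 h1
  have ⟨a2, b2⟩ := mul_ne_zero_iff.1 h2
  have ⟨a3, b3⟩ := mul_ne_zero_iff.1 h3
  generalize hA : 1 - q * P = A at *
  generalize hB : 1 - α * q * P = B at *
  generalize hC : 1 - Z * P = C at *
  field_simp

lemma R2_aux (n : ℕ) (X : ℝ) {α β : ℝ} {m : ℕ} {q : ℝ} (hq0 : 0 < q) (hq1 : q < 1)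
    (hα0 : 0 < α) (hα : α * q < 1) (K : ℕ) (hK : K ≤ m) :
    ∑ k ∈ Finset.range (K+1), (qcf n k α β m q *
        ((1 - β * q^m * X) * qpoch X q k - (1 - q^m * X) * qpoch (X / q) q k)
        - X * ((1 - α * q^(n+1)) * (1 - β * q^n) * (q^m / q^n)) *
          (qcf n k α β m q / (1 - α * q^(k+1))) * qpoch X q k)
      = X * qcf n K α β m q * (q^m / q^K) * (1 - q^K / q^n) * (1 - α * β * q^(n+1) * q^K)
          / (1 - α * q^(K+1)) * qpoch X q K := by
  have hne : ∀ k, 1 - α * q^(k+1) ≠ 0 := by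
    intro k
    have h1 : q^k ≤ 1 := pow_le_one₀ hq0.le hq1.le
    have h2 : 0 < q^k := by positivity
    have : α * q^(k+1) < 1 := by
      rw [pow_succ]; nlinarith [mul_pos hα0 hq0]
    linarith
  induction K with
  | zero =>
    have := hne 0
    simp only [zero_add, Finset.sum_range_one, qpoch_zero] at *
    simp only [pow_one, pow_succ q n] at *
    field_simp
    ring
  | succ K ih =>
    rw [Finset.sum_range_succ, ih (by omega)]
    have hs := qcf_succ n K (β := β) hq0 hq1 hα0 hα hK
    have h0 := hne K
    have h1 := hne (K+1)
    have hQK : q^(K+1) < 1 := pow_lt_one₀ hq0.le hq1 (by omega)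
    have hm : q^m < q^K := pow_lt_pow_right_of_lt_one₀ hq0 hq1 (by omega)
    have hm0 : 0 < q^m := by positivity
    have hK0 : 0 < q^K := by positivity
    have hn0 : 0 < q^n := by positivity
    have hX : qpoch (X / q) q (K+1) = (1 - X / q) * qpoch X q K := by
      rw [qpoch_succ', div_mul_cancel₀ _ hq0.ne']
    rw [hX, qpoch_succ X]
    have hs' : qcf n K α β m q * (1 - q^K / q^n) * (1 - α * β * q^(n+1) * q^K)
       = qcf n (K+1) α β m q * ((1 - q^(K+1)) * (1 - α * q^(K+1)) * (1 - q^K / q^m)) / q := by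
      field_simp
      field_simp at hs
      linear_combination -hs
    have key : X * qcf n K α β m q * (q^m / q^K) * (1 - q^K / q^n) * (1 - α * β * q^(n+1) * q^K)
          / (1 - α * q^(K+1)) * qpoch X q K = 
          X * qcf n (K+1) α β m q * (q^m / q^K) * ((1 - q^(K+1)) * (1 - q^K / q^m)) / q
           * qpoch X q K := by
      calc _ = X * (q^m / q^K) * (qcf n K α β m q * (1 - q^K / q^n) * (1 - α * β * q^(n+1) * q^K))
          / (1 - α * q^(K+1)) * qpoch X q K := by ring
        _ = _ := by rw [hs']; generalize 1 - α * q^(K+1) = D at *; field_simp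
    rw [key]
    generalize qcf n (K+1) α β m q = c at *
    generalize qpoch X q K = p at *
    simp only [pow_succ q n, pow_succ q K, pow_succ q (K+1)] at *
    generalize q^m = M at *
    generalize q^n = N at *
    generalize q^K = P at *
    clear hs hs' key ih hX
    generalize hD : 1 - α * (P * q * q) = D at *
    field_simp
    rw [← hD]
    ring

lemma R2_pol (n : ℕ) (X : ℝ) {α β : ℝ} {m : ℕ} {q : ℝ} (hq0 : 0 < q) (hq1 : q < 1)
    (hα0 : 0 < α) (hα : α * q < 1) (hn : n ≤ m) :
    ((1 - β * q^m * X) * qpol n X α β m q - (1 - q^m * X) * qpol n (X / q) α β m q) * (1 - α * q)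
      = X * ((1 - α * q^(n+1)) * (1 - β * q^n) * (q^m / q^n)) *
          qpol n X (α * q) (β / q) m q := by
  have h := R2_aux n X (β := β) hq0 hq1 hα0 hα n hn
  have hn0 : 0 < q^n := by positivity
  rw [div_self hn0.ne', sub_self, mul_zero, zero_mul, zero_div, zero_mul,
    Finset.sum_sub_distrib, sub_eq_zero] at h
  unfold qpol
  have h1 : (1 - β * q^m * X) * (∑ k ∈ Finset.range (n + 1), qcf n k α β m q * qpoch X q k)
    - (1 - q^m * X) * ∑ k ∈ Finset.range (n + 1), qcf n k α β m q * qpoch (X/q) q k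
    = ∑ k ∈ Finset.range (n+1), (qcf n k α β m q *
        ((1 - β * q^m * X) * qpoch X q k - (1 - q^m * X) * qpoch (X / q) q k)) := by
    rw [Finset.mul_sum, Finset.mul_sum, ← Finset.sum_sub_distrib]
    refine Finset.sum_congr rfl fun k _ => ?_
    ring
  rw [h1, h, Finset.sum_mul, Finset.mul_sum]
  refine Finset.sum_congr rfl fun k _ => ?_
  have h2 := qcf_prime n k (β := β) m hq0 hq1 hα0 hα
  have hne : 1 - α * q^(k+1) ≠ 0 := by
    have h1 : q^k ≤ 1 := pow_le_one₀ hq0.le hq1.le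
    have h2 : 0 < q^k := by positivity
    have : α * q^(k+1) < 1 := by
      rw [pow_succ]; nlinarith [mul_pos hα0 hq0]
    linarith
  have h3 : qcf n k α β m q / (1 - α * q^(k+1)) * (1 - α * q) = qcf n k (α * q) (β / q) m q := by
    rw [div_mul_eq_mul_div, div_eq_iff hne]; linear_combination -h2
  rw [← h3]; ring

lemma F_pol (n : ℕ) (X : ℝ) {α β : ℝ} {m : ℕ} {q : ℝ} (hq0 : 0 < q) (hq1 : q < 1)
    (hα0 : 0 < α) (hα : α * q < 1) (hn : n ≤ m) :
    (qpol (n+1) X α β (m+1) q - qpol (n+1) (X / q) α β (m+1) q)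
        * ((1 - α * q) * (1 - (q^(m+1))⁻¹))
      = X * ((1 - (q^(n+1))⁻¹) * (1 - α * β * q^(n+2))) * qpol n X (α * q) (β * q) m q := by
  unfold qpol
  rw [← Finset.sum_sub_distrib, Finset.sum_range_succ', Finset.mul_sum]
  simp only [qpoch_zero, sub_self, add_zero]
  rw [Finset.sum_mul]
  refine Finset.sum_congr rfl fun k hk => ?_
  have hk' : k ≤ m := by have := Finset.mem_range.1 hk; omega
  have hX : qpoch (X / q) q (k+1) = (1 - X / q) * qpoch X q k := by
    rw [qpoch_succ', div_mul_cancel₀ _ hq0.ne']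
  rw [hX, qpoch_succ X]
  unfold qcf
  have h1 := (qpoch_pos hq0 hq1 hq0 hq1 (k+1)).ne'
  have h2 := (qpoch_pos hq0 hq1 (by positivity : 0 < α * q) hα (k+1)).ne'
  have h3 := qpoch_neg_ne hq0 hq1 (show k + 1 ≤ m + 1 by omega)
  have e : ∀ l : ℕ, (q^(l+1))⁻¹ * q = (q^l)⁻¹ := by
    intro l; rw [pow_succ]; field_simp
  rw [qpoch_succ' ((q^(n+1))⁻¹), qpoch_succ' ((q^(m+1))⁻¹), qpoch_succ' (α * q),
    qpoch_succ' (α * β * q^(n+1+1)), qpoch_succ q, e, e]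
  rw [qpoch_succ] at h1
  rw [qpoch_succ'] at h2
  rw [qpoch_succ', e] at h3
  have e2 : α * q * (β * q) * q^(n+1) = α * β * q^(n+1+1) * q := by ring
  have e3 : α * β * q^(n+2) = α * β * q^(n+1+1) := by ring
  rw [e2, e3, pow_succ q k]
  have ⟨a1, b1⟩ := mul_ne_zero_iff.1 h1
  have ⟨a2, b2⟩ := mul_ne_zero_iff.1 h2
  have ⟨a3, b3⟩ := mul_ne_zero_iff.1 h3
  have e4 : qpoch X q k * (1 - X * q^k) - (1 - X / q) * qpoch X q k
    = qpoch X q k * X * (1 - q * q^k) / q := by field_simp; ring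
  rw [← mul_sub, e4]
  generalize 1 - (q^(m+1))⁻¹ = Z at *
  generalize 1 - (q^(n+1))⁻¹ = Y at *
  generalize 1 - α * q = V at *
  generalize 1 - q * q^k = V' at *
  field_simp


lemma one_sub_pow_pos {a q : ℝ} (hq0 : 0 < q) (hq1 : q < 1) (ha : a < 1) (ha0 : 0 < a) (k : ℕ) :
    0 < 1 - a * q^k := by
  have h1 : q^k ≤ 1 := pow_le_one₀ hq0.le hq1.le
  have h2 : 0 < q^k := by positivity
  nlinarith

lemma pow_sub_pos' {b q : ℝ} (hq0 : 0 < q) (hq1 : q < 1) (hb0 : 0 < b) (hb : b * q < 1)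
    {x m : ℕ} (h : x < m) : 0 < q^x - b * q^m := by
  obtain ⟨d, rfl⟩ : ∃ d, m = x + 1 + d := ⟨m - (x+1), by omega⟩
  have h1 : q^d ≤ 1 := pow_le_one₀ hq0.le hq1.le
  have h2 : 0 < q^d := by positivity
  have h3 : 0 < q^x := by positivity
  have h4 : b * q * q^d < 1 := by nlinarith [mul_pos hb0 hq0]
  have : q^x - b * q^(x+1+d) = q^x * (1 - b * q * q^d) := by ring
  rw [this]; apply mul_pos h3; linarith

lemma pow_sub_pos'' {b q : ℝ} (hq0 : 0 < q) (hq1 : q < 1) (hb0 : 0 < b) (hb : b < 1)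
    {x m : ℕ} (h : x ≤ m) : 0 < q^x - b * q^m := by
  have h1 : q^m ≤ q^x := pow_le_pow_of_le_one hq0.le hq1.le h
  have h2 : 0 < q^m := by positivity
  nlinarith

lemma W_zero (α β : ℝ) (m : ℕ) (q : ℝ) : qhahnW 0 α β m q = 1 := by
  simp [qhahnW, qpoch_zero]

lemma W_succ {α β q : ℝ} {m x : ℕ} (hq0 : 0 < q) (hq1 : q < 1) (hα0 : 0 < α)
    (hβ0 : 0 < β) (hβ : β * q < 1) (hx : x < m) :
    qhahnW (x+1) α β m q * ((1 - q^(x+1)) * (q^x - β * q^m) * (α * q))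
      = qhahnW x α β m q * ((1 - α * q^(x+1)) * (q^x - q^m)) := by
  unfold qhahnW
  have h1 : 0 < 1 - q^(x+1) := by
    have := pow_lt_one₀ hq0.le hq1 (Nat.succ_ne_zero x); simpa using this
  have h2 := pow_sub_pos' hq0 hq1 hβ0 hβ hx
  simp only [_root_.zpow_neg, zpow_natCast, qpoch_succ]
  have h3 : q^m > 0 := by positivity
  have h4 : q^x > 0 := by positivity
  have e1 : 1 - (q^m)⁻¹ / β * q^x = -(q^x - β * q^m) / (β * q^m) := by field_simp; ring
  have e2 : 1 - (q^m)⁻¹ * q^x = -(q^x - q^m) / (q^m) := by field_simp; ring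
  have e3 : 1 - q * q^x = 1 - q^(x+1) := by ring
  have e4 : 1 - α * q * q^x = 1 - α * q^(x+1) := by ring
  rw [e1, e2, e3, e4, pow_succ (α * β * q)]
  generalize (α * β * q)^x = Y
  generalize qpoch ((q^m)⁻¹ / β) q x = A1
  generalize qpoch ((q^m)⁻¹) q x = A2
  generalize q^x - β * q^m = A3 at *
  generalize 1 - q^(x+1) = A4 at *
  simp only [div_eq_mul_inv, _root_.mul_inv_rev, inv_inv, neg_mul, inv_neg]
  field_simp

lemma W_pos {α β q : ℝ} {m : ℕ} (hq0 : 0 < q) (hq1 : q < 1) (hα0 : 0 < α) (hα : α * q < 1)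
    (hβ0 : 0 < β) (hβ : β * q < 1) (x : ℕ) (hx : x ≤ m) : 0 < qhahnW x α β m q := by
  induction x with
  | zero => rw [W_zero]; norm_num
  | succ x ih =>
    have ih := ih (by omega)
    have h := W_succ hq0 hq1 hα0 hβ0 hβ (show x < m by omega)
    have h1 : 0 < 1 - q^(x+1) := by
      have := pow_lt_one₀ hq0.le hq1 (Nat.succ_ne_zero x); simpa using this
    have h2 := pow_sub_pos' hq0 hq1 hβ0 hβ hx
    have h3 : 0 < q^x - q^m := by
      have := pow_lt_pow_right_of_lt_one₀ hq0 hq1 (show x < m by omega); linarith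
    have h4 := one_sub_pow_pos hq0 hq1 hα (by positivity) x
    have h5 : 1 - α * q^(x+1) = 1 - α * q * q^x := by ring
    rw [h5] at h
    have h6 : 0 < (1 - q^(x+1)) * (q^x - β * q^m) * (α * q) := by positivity
    have h7 : 0 < qhahnW x α β m q * ((1 - α * q * q^x) * (q^x - q^m)) := by positivity
    rw [← h] at h7
    exact (pos_iff_pos_of_mul_pos h7).2 h6

lemma W_prime {α β q : ℝ} {m : ℕ} (hq0 : 0 < q) (hq1 : q < 1) (hα0 : 0 < α)
    (hβ0 : 0 < β) (hβ : β < 1) (x : ℕ) (hx : x ≤ m) :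
    qhahnW x (α * q) (β / q) m q * ((1 - α * q) * (q^x - β * q^m))
      = qhahnW x α β m q * ((1 - α * q^(x+1)) * (1 - β * q^m)) := by
  induction x with
  | zero => simp [W_zero]
  | succ x ih =>
    have ih := ih (by omega)
    have h := W_succ hq0 hq1 hα0 hβ0 (show β * q < 1 by nlinarith) (show x < m by omega)
    have h' := W_succ hq0 hq1 (show 0 < α * q by positivity) (show 0 < β / q by positivity)
      (show β / q * q < 1 by rwa [div_mul_cancel₀ _ hq0.ne']) (show x < m by omega)
    have h1 : 0 < 1 - q^(x+1) := by
      have := pow_lt_one₀ hq0.le hq1 (Nat.succ_ne_zero x); simpa using this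
    have h2 := pow_sub_pos'' hq0 hq1 hβ0 hβ (show x ≤ m by omega)
    have h3 := pow_sub_pos'' hq0 hq1 hβ0 hβ hx
    generalize qhahnW x α β m q = w at *
    generalize qhahnW x (α * q) (β / q) m q = w' at *
    generalize qhahnW (x+1) α β m q = u at *
    generalize qhahnW (x+1) (α * q) (β / q) m q = u' at *
    have h4 : u' * ((1 - q^(x+1)) * (q^(x+1) - β * q^m) * (α * q))
      = w' * ((1 - α * q^(x+2)) * (q^x - q^m)) := by
      have e : q^x - β / q * q^m = (q^(x+1) - β * q^m) / q := by rw [pow_succ]; field_simp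
      rw [e] at h'
      have : (α * q * q^(x+1)) = α * q^(x+2) := by ring
      rw [this] at h'
      rw [← h']; field_simp
    have h5 : (1 - q^(x+1)) * (q^x - β * q^m) * (α * q) ≠ 0 := by positivity
    apply mul_right_cancel₀ h5
    have e6 : q^(x+1+1) = q^(x+2) := rfl
    rw [e6]
    linear_combination (1 - α * q) * (q^x - β * q^m) * h4 
      + (1 - α * q^(x+2)) * (q^x - q^m) * ih - (1 - α * q^(x+2)) * (1 - β * q^m) * h

lemma W_pprime {α β q : ℝ} {m : ℕ} (hq0 : 0 < q) (hq1 : q < 1) (hα0 : 0 < α)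
    (hβ0 : 0 < β) (hβ : β < 1) (x : ℕ) (hx : x ≤ m) :
    qhahnW x (α * q) (β * q) m q * ((1 - α * q) * (1 - q^(m+1)) * (q^x)^2)
      = qhahnW x α β (m+1) q * ((1 - α * q^(x+1)) * (q^x - q^(m+1))) := by
  induction x with
  | zero => simp [W_zero]
  | succ x ih =>
    have ih := ih (by omega)
    have hβ' : β * q < 1 := by nlinarith
    have h := W_succ hq0 hq1 hα0 hβ0 hβ' (show x < m + 1 by omega)
    have h' := W_succ hq0 hq1 (show 0 < α * q by positivity) (show 0 < β * q by positivity)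
      (show β * q * q < 1 by nlinarith [mul_pos hβ0 hq0]) (show x < m by omega)
    have h1 : 0 < 1 - q^(x+1) := by
      have := pow_lt_one₀ hq0.le hq1 (Nat.succ_ne_zero x); simpa using this
    have h2 := pow_sub_pos'' hq0 hq1 hβ0 hβ (show x ≤ m + 1 by omega)
    generalize qhahnW x α β (m+1) q = w at *
    generalize qhahnW x (α * q) (β * q) m q = w' at *
    generalize qhahnW (x+1) α β (m+1) q = u at *
    generalize qhahnW (x+1) (α * q) (β * q) m q = u' at *
    have h5 : (1 - q^(x+1)) * (q^x - β * q^(m+1)) * (α * q) ≠ 0 := by positivity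
    apply mul_right_cancel₀ h5
    simp only [pow_succ q x, pow_succ q m, pow_succ q (x+1)] at *
    generalize q^x = P at *
    generalize q^m = M at *
    linear_combination (1 - α * q) * (1 - M * q) * P^2 * q * h'
      + (1 - α * (P * q * q)) * (P * q - M * q) * ih 
      - (1 - α * (P * q * q)) * (P * q - M * q) * h

lemma W_m {α β q : ℝ} {m : ℕ} (hq0 : 0 < q) (hq1 : q < 1) (hα0 : 0 < α)
    (hβ0 : 0 < β) (hβ : β < 1) (x : ℕ) (hx : x ≤ m) :
    qhahnW x α β (m+1) q * ((q^x - q^(m+1)) * (1 - β * q^(m+1)))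
      = qhahnW x α β m q * ((1 - q^(m+1)) * (q^x - β * q^(m+1))) := by
  induction x with
  | zero => simp [W_zero]
  | succ x ih =>
    have ih := ih (by omega)
    have hβ' : β * q < 1 := by nlinarith
    have h := W_succ hq0 hq1 hα0 hβ0 hβ' (show x < m + 1 by omega)
    have h' := W_succ hq0 hq1 hα0 hβ0 hβ' (show x < m by omega)
    have h1 : 0 < 1 - q^(x+1) := by
      have := pow_lt_one₀ hq0.le hq1 (Nat.succ_ne_zero x); simpa using this
    have h2 := pow_sub_pos'' hq0 hq1 hβ0 hβ (show x ≤ m + 1 by omega)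
    generalize qhahnW x α β (m+1) q = w at *
    generalize qhahnW x α β m q = w' at *
    generalize qhahnW (x+1) α β (m+1) q = u at *
    generalize qhahnW (x+1) α β m q = u' at *
    have h5 : (1 - q^(x+1)) * (q^x - β * q^(m+1)) * (α * q) ≠ 0 := by positivity
    apply mul_right_cancel₀ h5
    simp only [pow_succ q x, pow_succ q m] at *
    generalize q^x = P at *
    generalize q^m = M at *
    linear_combination (P * q - M * q) * (1 - β * (M * q)) * h
      + (1 - α * (P * q)) * (P - M) * q * ih 
      - (1 - M * q) * (P - β * (M * q)) * q * h'

lemma vander_aux {α β q : ℝ} {m : ℕ} (hq0 : 0 < q) (hq1 : q < 1) (hα0 : 0 < α)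
    (hβ0 : 0 < β) (hβ : β < 1) (K : ℕ) (hK : K ≤ m) :
    ∑ x ∈ Finset.range (K+1), qhahnW x α β (m+1) q * (α * q * (1 - β * q^(m+1)))
     = ∑ x ∈ Finset.range K, (1 - α * β * q^2 * q^m) * qhahnW x α β m q
        + (α * q * q^K - α * β * q^2 * q^m) * qhahnW K α β m q := by
  induction K with
  | zero => simp [W_zero]; ring
  | succ K ih =>
    rw [Finset.sum_range_succ, ih (by omega), Finset.sum_range_succ _ K]
    have hβ' : β * q < 1 := by nlinarith
    have h' := W_succ hq0 hq1 hα0 hβ0 hβ' (show K < m by omega)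
    have h := W_m hq0 hq1 hα0 hβ0 hβ (K+1) hK
    generalize qhahnW K α β m q = w' at *
    generalize qhahnW (K+1) α β (m+1) q = u at *
    generalize qhahnW (K+1) α β m q = u' at *
    have h3 : 0 < q^(K+1) - q^(m+1) := by
      have := pow_lt_pow_right_of_lt_one₀ hq0 hq1 (show K + 1 < m + 1 by omega); linarith
    apply mul_right_cancel₀ h3.ne'
    simp only [pow_succ q K, pow_succ q m] at *
    generalize q^K = P at *
    generalize q^m = M at *
    linear_combination α * q * h + q * h'

lemma vander_step {α β q : ℝ} (m : ℕ) (hq0 : 0 < q) (hq1 : q < 1) (hα0 : 0 < α)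
    (hβ0 : 0 < β) (hβ : β < 1) :
    (∑ x ∈ Finset.range (m+2), qhahnW x α β (m+1) q) * (α * q * (1 - β * q^(m+1)))
     = (1 - α * β * q^2 * q^m) * ∑ x ∈ Finset.range (m+1), qhahnW x α β m q := by
  rw [Finset.sum_range_succ, add_mul, Finset.sum_mul, vander_aux hq0 hq1 hα0 hβ0 hβ m le_rfl,
    Finset.sum_range_succ _ m, ← Finset.mul_sum]
  have hβ' : β * q < 1 := by nlinarith
  have h := W_succ hq0 hq1 hα0 hβ0 hβ' (show m < m + 1 by omega)
  have h' := W_m hq0 hq1 hα0 hβ0 hβ m le_rfl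
  have h1 : 0 < 1 - q^(m+1) := by
    have := pow_lt_one₀ hq0.le hq1 (Nat.succ_ne_zero m); simpa using this
  have h2 := pow_sub_pos'' hq0 hq1 hβ0 hβ (show m ≤ m + 1 by omega)
  generalize qhahnW m α β (m+1) q = w at *
  generalize qhahnW m α β m q = w' at *
  generalize qhahnW (m+1) α β (m+1) q = u at *
  have h5 : (1 - q^(m+1)) * (q^m - β * q^(m+1)) ≠ 0 := by positivity
  apply mul_right_cancel₀ h5
  simp only [pow_succ q m] at *
  generalize q^m = M at *
  linear_combination (1 - β * (M * q)) * h + (1 - α * (M * q)) * h'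

lemma vander_s16 {α β q : ℝ} (m : ℕ) (hq0 : 0 < q) (hq1 : q < 1) (hα0 : 0 < α)
    (hβ0 : 0 < β) (hβ : β < 1) :
    (∑ x ∈ Finset.range (m+1), qhahnW x α β m q) 
     = qpoch (α * β * q^2) q m / (qpoch (β * q) q m * (α * q)^m) := by
  induction m with
  | zero => simp [W_zero, qpoch_zero]
  | succ m ih =>
    have h := vander_step m hq0 hq1 hα0 hβ0 hβ
    have hβ' : β * q < 1 := by nlinarith
    have h1 := (qpoch_pos hq0 hq1 (by positivity : 0 < β * q) hβ' m).ne'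
    have h2 := one_sub_pow_pos hq0 hq1 hβ hβ0 (m+1)
    rw [ih] at h
    have e1 : 1 - β * q * q^m = 1 - β * q^(m+1) := by ring
    rw [qpoch_succ, qpoch_succ, e1, pow_succ (α * q)]
    generalize 1 - β * q^(m+1) = D at *
    have h3 : α * q * D ≠ 0 := by positivity
    apply mul_right_cancel₀ h3
    rw [h]
    field_simp


lemma Q_zero_n (x : ℕ) (α β : ℝ) (m : ℕ) (q : ℝ) : qhahnQ 0 x α β m q = 1 := by
  simp [qhahnQ, qpoch_zero]

lemma Q_zero_x (n : ℕ) (α β : ℝ) (m : ℕ) (q : ℝ) : qhahnQ n 0 α β m q = 1 := by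
  rw [qhahnQ_eq]
  unfold qpol
  rw [Finset.sum_range_succ']
  simp [qpoch_succ', qpoch_zero, qcf]

lemma R1 {α β q : ℝ} (n m x : ℕ) (hq0 : 0 < q) (hq1 : q < 1) (hα0 : 0 < α) (hα : α * q < 1) :
    (1 - α * q^(x+2)) * qhahnQ n (x+1) (α * q) (β / q) m q
      - α * q * (1 - q^(x+1)) * qhahnQ n x (α * q) (β / q) m q
      = (1 - α * q) * qhahnQ n (x+1) α β m q := by
  have h := R1_pol n ((q^(x+1))⁻¹) (β := β) m hq0 hq1 hα0 hα
  have e : (q^(x+1))⁻¹ * q = (q^x)⁻¹ := by rw [pow_succ]; field_simp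
  rw [e] at h
  simp only [← qhahnQ_eq] at h
  have h1 : q^(x+1) ≠ 0 := by positivity
  field_simp at h
  linear_combination h

lemma R2 {α β q : ℝ} {n m : ℕ} (x : ℕ) (hq0 : 0 < q) (hq1 : q < 1) (hα0 : 0 < α)
    (hα : α * q < 1) (hn : n ≤ m) :
    ((q^x - β * q^m) * qhahnQ n x α β m q - (q^x - q^m) * qhahnQ n (x+1) α β m q) * (1 - α * q)
      = ((1 - α * q^(n+1)) * (1 - β * q^n) * (q^m / q^n)) * qhahnQ n x (α * q) (β / q) m q := by
  have h := R2_pol n ((q^x)⁻¹) (β := β) hq0 hq1 hα0 hα hn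
  have e : (q^x)⁻¹ / q = (q^(x+1))⁻¹ := by rw [pow_succ]; field_simp
  rw [e] at h
  simp only [← qhahnQ_eq] at h
  have h1 : q^x ≠ 0 := by positivity
  generalize ((1 - α * q^(n+1)) * (1 - β * q^n) * (q^m / q^n)) = L at *
  field_simp at h
  linear_combination h

lemma Fwd {α β q : ℝ} {n m : ℕ} (x : ℕ) (hq0 : 0 < q) (hq1 : q < 1) (hα0 : 0 < α)
    (hα : α * q < 1) (hn : n ≤ m) :
    (qhahnQ (n+1) x α β (m+1) q - qhahnQ (n+1) (x+1) α β (m+1) q)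
        * ((1 - α * q) * (1 - (q^(m+1))⁻¹)) * q^x
      = ((1 - (q^(n+1))⁻¹) * (1 - α * β * q^(n+2))) * qhahnQ n x (α * q) (β * q) m q := by
  have h := F_pol n ((q^x)⁻¹) (β := β) hq0 hq1 hα0 hα hn
  have e : (q^x)⁻¹ / q = (q^(x+1))⁻¹ := by rw [pow_succ]; field_simp
  rw [e] at h
  simp only [← qhahnQ_eq] at h
  rw [h]
  have h1 : q^x ≠ 0 := by positivity
  calc _ = (q^x * (q^x)⁻¹) * ((1 - (q^(n+1))⁻¹) * (1 - α * β * q^(n+2))) * qhahnQ n x (α * q) (β * q) m q := by ring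
    _ = _ := by rw [mul_inv_cancel₀ h1, one_mul]

lemma diff_eq {α β q : ℝ} {n m : ℕ} (x : ℕ) (hq0 : 0 < q) (hq1 : q < 1) (hα0 : 0 < α)
    (hα : α * q < 1) (hn : n ≤ m) :
    q^m * ((q^n)⁻¹ - 1) * (1 - α * β * q^(n+1)) * qhahnQ n (x+1) α β m q
     = (1 - α * q^(x+2)) * (q^(x+1) - q^m) * (qhahnQ n (x+1) α β m q - qhahnQ n (x+2) α β m q)
       - α * q * (1 - q^(x+1)) * (q^x - β * q^m)
         * (qhahnQ n x α β m q - qhahnQ n (x+1) α β m q) := by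
  have h1 := R1 (β := β) n m x hq0 hq1 hα0 hα
  have h2 := R2 (β := β) (n := n) (m := m) x hq0 hq1 hα0 hα hn
  have h3 := R2 (β := β) (n := n) (m := m) (x+1) hq0 hq1 hα0 hα hn
  have h4 : 1 - α * q ≠ 0 := by linarith
  have h5 : q^n ≠ 0 := by positivity
  apply mul_right_cancel₀ h4
  have eL : (1 - α * q^(n+1)) * (1 - β * q^n) * (q^m / q^n) = 
    q^m * ((q^n)⁻¹ - 1) * (1 - α * β * q^(n+1)) + q^m * (1 - β) * (1 - α * q) := by
    field_simp; ring
  rw [eL] at h2 h3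
  generalize q^m * ((q^n)⁻¹ - 1) * (1 - α * β * q^(n+1)) = L at *
  have e1 : q^(x+2) = q^x * q^2 := by ring
  have e2 : q^(x+1) = q^x * q := by ring
  have e3 : x + 1 + 1 = x + 2 := rfl
  rw [e3] at h3
  rw [e1, e2] at *
  linear_combination (-(L + q^m * (1 - β) * (1 - α * q))) * h1 - (1 - α * (q^x * q^2)) * h3
    + α * q * (1 - q^x * q) * h2

lemma diff_eq0 {α β q : ℝ} {n m : ℕ} (hq0 : 0 < q) (hq1 : q < 1) (hα0 : 0 < α)
    (hα : α * q < 1) (hn : n ≤ m) :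
    q^m * ((q^n)⁻¹ - 1) * (1 - α * β * q^(n+1)) 
     = (1 - α * q) * (1 - q^m) * (1 - qhahnQ n 1 α β m q) := by
  have h2 := R2 (β := β) (n := n) (m := m) 0 hq0 hq1 hα0 hα hn
  have h5 : q^n ≠ 0 := by positivity
  have eL : (1 - α * q^(n+1)) * (1 - β * q^n) * (q^m / q^n) = 
    q^m * ((q^n)⁻¹ - 1) * (1 - α * β * q^(n+1)) + q^m * (1 - β) * (1 - α * q) := by
    field_simp; ring
  rw [eL, Q_zero_x, Q_zero_x, zero_add, pow_zero] at h2
  linear_combination -h2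

lemma parseval_aux {α β q : ℝ} {n m : ℕ} (hq0 : 0 < q) (hq1 : q < 1) (hα0 : 0 < α)
    (hα : α * q < 1) (hβ0 : 0 < β) (hβ : β < 1) (hn : n ≤ m) (K : ℕ) (hK : K ≤ m) :
    ∑ x ∈ Finset.range (K+1), q^m * ((q^n)⁻¹ - 1) * (1 - α * β * q^(n+1)) *
        (qhahnW x α β m q * qhahnQ n x α β m q ^ 2)
    = ∑ x ∈ Finset.range K, qhahnW x α β m q * ((1 - α * q^(x+1)) * (q^x - q^m)) *
        (qhahnQ n x α β m q - qhahnQ n (x+1) α β m q)^2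
      + qhahnW K α β m q * ((1 - α * q^(K+1)) * (q^K - q^m)) *
        (qhahnQ n K α β m q - qhahnQ n (K+1) α β m q) * qhahnQ n K α β m q := by
  induction K with
  | zero =>
    have := diff_eq0 (β := β) hq0 hq1 hα0 hα hn
    simp [W_zero, Q_zero_x]
    linear_combination this
  | succ K ih =>
    rw [Finset.sum_range_succ, ih (by omega), Finset.sum_range_succ _ K]
    have h1 := diff_eq (β := β) K hq0 hq1 hα0 hα hn
    have hβ' : β * q < 1 := by nlinarith
    have h2 := W_succ hq0 hq1 hα0 hβ0 hβ' (show K < m by omega)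
    have e3 : K + 1 + 1 = K + 2 := rfl
    rw [e3]
    linear_combination qhahnW (K+1) α β m q * qhahnQ n (K+1) α β m q * h1 
      - (qhahnQ n K α β m q - qhahnQ n (K+1) α β m q) * qhahnQ n (K+1) α β m q * h2

lemma norm_rec {α β q : ℝ} {n m : ℕ} (hq0 : 0 < q) (hq1 : q < 1) (hα0 : 0 < α)
    (hα : α * q < 1) (hβ0 : 0 < β) (hβ : β < 1) (hn : n ≤ m) :
    (∑ x ∈ Finset.range (m+2), qhahnW x α β (m+1) q * qhahnQ (n+1) x α β (m+1) q ^ 2)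
      * (q^(m+1) * ((q^(n+1))⁻¹ - 1) * (1 - α * β * q^(n+2)))
      * ((1 - α * q) * (1 - (q^(m+1))⁻¹))^2
    = ((1 - (q^(n+1))⁻¹) * (1 - α * β * q^(n+2)))^2 * ((1 - α * q) * (1 - q^(m+1))) *
     (∑ x ∈ Finset.range (m+1), qhahnW x (α * q) (β * q) m q * qhahnQ n x (α * q) (β * q) m q ^ 2)
    := by
  have h := parseval_aux hq0 hq1 hα0 hα hβ0 hβ (show n + 1 ≤ m + 1 by omega) (m+1) le_rfl
  rw [sub_self, mul_zero, mul_zero, zero_mul, zero_mul, add_zero, ← Finset.mul_sum] at h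
  have e3 : n + 1 + 1 = n + 2 := rfl
  rw [e3] at h
  rw [mul_comm (∑ x ∈ Finset.range (m+2), _), h, Finset.sum_mul, Finset.mul_sum]
  refine Finset.sum_congr rfl fun x hx => ?_
  have hx' : x ≤ m := by have := Finset.mem_range.1 hx; omega
  have h1 := W_pprime hq0 hq1 hα0 hβ0 hβ x hx'
  have h2 := Fwd (β := β) x hq0 hq1 hα0 hα hn
  rw [← h1]
  have h3 := congrArg (fun z => z^2) h2
  linear_combination qhahnW x (α * q) (β * q) m q * ((1 - α * q) * (1 - q^(m+1))) * h3

set_option maxHeartbeats 4000000 in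
lemma H_rec {α β q : ℝ} {n m : ℕ} (hq0 : 0 < q) (hq1 : q < 1) (hα0 : 0 < α)
    (hα : α * q < 1) (hβ0 : 0 < β) (hβ : β < 1) (hn : n ≤ m) :
    qhahnH (n+1) α β (m+1) q
      * (q^(m+1) * ((q^(n+1))⁻¹ - 1) * (1 - α * β * q^(n+2)))
      * ((1 - α * q) * (1 - (q^(m+1))⁻¹))^2
    = ((1 - (q^(n+1))⁻¹) * (1 - α * β * q^(n+2)))^2 * ((1 - α * q) * (1 - q^(m+1))) *
     qhahnH n (α * q) (β * q) m q := by
  have hβ' : β * q < 1 := by nlinarith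
  have hab : α * β * q < 1 := by nlinarith [mul_pos hα0 hq0]
  have hab0 : 0 < α * β * q := by positivity
  unfold qhahnH
  simp only [_root_.zpow_neg, zpow_natCast]
  have e : ∀ l : ℕ, (q^(l+1))⁻¹ * q = (q^l)⁻¹ := by
    intro l; rw [pow_succ]; field_simp
  have hneg := qpoch_neg_ne hq0 hq1 (show n + 1 ≤ m + 1 by omega)
  rw [qpoch_succ', e] at hneg
  obtain ⟨c1, c2⟩ := mul_ne_zero_iff.1 hneg
  have z : q ^ (((n+1).choose 2 : ℤ) - ((m+1 : ℕ) : ℤ) * ((n+1 : ℕ) : ℤ))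
     = q ^ ((n.choose 2 : ℤ) - (m : ℤ) * n) * (q^(m+1))⁻¹ := by
    rw [← zpow_natCast q (m+1), ← _root_.zpow_neg, ← zpow_add₀ hq0.ne']
    congr 1
    rw [Nat.choose_succ_succ' n 1]
    push_cast
    simp
    ring
  rw [z]
  have p2 := one_sub_pow_pos hq0 hq1 hab hab0
  -- rewriting the individual factors
  have s1 := qpoch_shift (α * β * q^3) q m
  have s2 := qpoch_shift (α * β * q^2) q n
  rw [qpoch_succ' (α * β * q^2), qpoch_succ q, qpoch_succ' (α * β * q^(m+1+2)), 
    qpoch_succ' (β * q), qpoch_succ' (β * q), qpoch_succ' (α * q), qpoch_succ' (α * β * q),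
    qpoch_succ' ((q^(m+1))⁻¹), e]
  have t1 : α * q * (β * q) * q^2 = α * β * q^3 * q := by ring
  have t2 : α * q * (β * q) * q^(m+2) = α * β * q^(m+1+2) * q := by ring
  have t3 : α * q * (β * q) * q = α * β * q^3 := by ring
  have t4 : α * q * (β * q) * q^(2*n+1) = α * β * q^(2*n+3) := by ring
  have t5 : α * β * q^(2*(n+1)+1) = α * β * q^(2*n+3) := by ring
  have t6 : α * β * q^2 * q = α * β * q^3 := by ring
  have t7 : α * β * q * q = α * β * q^2 := by ring
  have t8 : α * β * q^3 * q^m = α * β * q^(m+1+2) := by ring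
  have t9 : α * β * q^2 * q^n = α * β * q^(n+2) := by ring
  rw [t8] at s1
  rw [t6, t9] at s2
  rw [t1, t2, t3, t4, t5, t6, t7]
  have d1 : 1 - α * β * q^(2*n+3) ≠ 0 := by
    have := (p2 (2*n+2)).ne'
    rwa [show α * β * q * q^(2*n+2) = α * β * q^(2*n+3) by ring] at this
  have d2 : 1 - α * β * q^(m+1+2) ≠ 0 := by
    have := (p2 (m+2)).ne'
    rwa [show α * β * q * q^(m+2) = α * β * q^(m+1+2) by ring] at this
  have d3 : 1 - α * β * q^(n+2) ≠ 0 := by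
    have := (p2 (n+1)).ne'
    rwa [show α * β * q * q^(n+1) = α * β * q^(n+2) by ring] at this
  have d4 : 1 - α * β * q^2 ≠ 0 := by
    have := (p2 1).ne'
    rwa [show α * β * q * q^1 = α * β * q^2 by ring] at this
  have d5 : 1 - α * β * q^3 ≠ 0 := by
    have := (p2 2).ne'
    rwa [show α * β * q * q^2 = α * β * q^3 by ring] at this
  have d6 : 1 - α * β * q ≠ 0 := by linarith
  have d7 : 1 - α * q ≠ 0 := by linarith
  have d8 : 1 - β * q ≠ 0 := by linarith
  have q3 : 0 < α * β * q^3 := by positivity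
  have q3' : α * β * q^3 < 1 := by
    have : α * β * q^3 = α * β * q * q^2 := by ring
    have h2 : q^2 < 1 := by nlinarith
    nlinarith
  have q2' : α * β * q^2 < 1 := by nlinarith
  have f1 := (qpoch_pos hq0 hq1 q3 q3' n).ne'
  have f2 := (qpoch_pos hq0 hq1 (by positivity : 0 < β * q * q) (by nlinarith [mul_pos hβ0 hq0]) m).ne'
  have f3 := (qpoch_pos hq0 hq1 (by positivity : 0 < α * q * q) (by nlinarith [mul_pos hα0 hq0]) n).ne'
  have f4 := (qpoch_pos hq0 hq1 (by positivity : 0 < α * β * q^2) q2' n).ne'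
  have s1' : qpoch (α * β * q^3) q m = 
     (1 - α * β * q^3) * qpoch (α * β * q^3 * q) q m / (1 - α * β * q^(m+1+2)) := by
    rw [s1]; field_simp
  have s2' : qpoch (α * β * q^2) q n = 
     (1 - α * β * q^2) * qpoch (α * β * q^3) q n / (1 - α * β * q^(n+2)) := by
    rw [s2]; field_simp
  rw [s1', s2']
  have g1 : (-(α * q * q))^n = (-(α * q))^n * q^n := by rw [← mul_pow]; congr 1; ring
  have g2 : (α * q * q)^m = (α * q)^m * q^m := by rw [← mul_pow]
  rw [g1, g2, pow_succ (-(α * q)), pow_succ (α * q)]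
  have qm : q^m ≠ 0 := by positivity
  have qn : q^n ≠ 0 := by positivity
  have k1 : 1 - q^(m+1) ≠ 0 := by
    have := pow_lt_one₀ hq0.le hq1 (Nat.succ_ne_zero m)
    simp only [Nat.succ_eq_add_one] at this
    linarith
  have k2 : 1 - (q^(m+1))⁻¹ = -(1 - q^(m+1)) / (q^m * q) := by rw [pow_succ]; field_simp; ring
  have k3 : 1 - (q^(n+1))⁻¹ = -(1 - q^(n+1)) / (q^n * q) := by rw [pow_succ]; field_simp; ring
  have k4 : (q^(n+1))⁻¹ - 1 = (1 - q^(n+1)) / (q^n * q) := by rw [pow_succ]; field_simp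
  have k5 : 1 - q * q^n = 1 - q^(n+1) := by ring
  have k6 : (q^(m+1))⁻¹ = (q^m * q)⁻¹ := by rw [pow_succ]
  rw [k2, k3, k4, k5, k6]
  clear s1 s2 s1' s2' t1 t2 t3 t4 t5 t6 t7 t8 t9 z g1 g2 k2 k3 k4 k5 k6 hneg c1 p2 e q3 q3' q2' hab
  rw [show q^(m+1) * _ = q^m * q * _ by rw [pow_succ]]
  generalize 1 - q^(m+1) = A1 at *
  generalize 1 - q^(n+1) = A2 at *
  generalize 1 - α * β * q^(2*n+3) = A3 at *
  generalize 1 - α * β * q^(m+1+2) = A4 at *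
  generalize 1 - α * β * q^(n+2) = A5 at *
  generalize qpoch ((q^m)⁻¹) q n = A6 at *
  generalize 1 - α * β * q^2 = A7 at *
  generalize 1 - α * β * q^3 = A8 at *
  generalize 1 - α * β * q = A9 at *
  generalize 1 - α * q = A10 at *
  generalize 1 - β * q = A11 at *
  generalize qpoch (α * β * q^3) q n = B1 at *
  generalize qpoch (β * q * q) q m = B2 at *
  generalize qpoch (α * q * q) q n = B3 at *
  generalize qpoch (α * β * q^2) q n = B4 at *
  generalize q ^ ((n.choose 2 : ℤ) - (m : ℤ) * n) = B5 at *
  generalize qpoch (α * β * q^3 * q) q m = B6 at *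
  generalize qpoch (α * β * q^(m+1+2) * q) q n = B7 at *
  generalize qpoch (β * q * q) q n = B8 at *
  generalize (-(α * q))^n = B9 at *
  generalize hB10 : (α * q)^m = B10 at *
  have hB : B10 ≠ 0 := by rw [← hB10]; positivity
  clear hB10
  generalize q^m = M at *
  generalize q^n = N at *
  field_simp

lemma norm_eq {q : ℝ} (hq0 : 0 < q) (hq1 : q < 1) (n : ℕ) : ∀ (m : ℕ) (α β : ℝ) (_ : 0 < α)
    (_ : α * q < 1) (_ : 0 < β) (_ : β < 1) (_ : n ≤ m),
    (∑ x ∈ Finset.range (m+1), qhahnW x α β m q * qhahnQ n x α β m q ^ 2) = qhahnH n α β m q := by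
  induction n with
  | zero =>
    intro m α β hα0 hα hβ0 hβ _
    have hab : α * β * q < 1 := by nlinarith [mul_pos hα0 hq0]
    have h : 1 - α * β * q ≠ 0 := by linarith
    simp only [Q_zero_n, one_pow, mul_one]
    rw [vander_s16 m hq0 hq1 hα0 hβ0 hβ]
    simp only [qhahnH, qpoch_zero]
    simp
    rw [mul_div_mul_right _ _ h]
  | succ n ih =>
    intro m α β hα0 hα hβ0 hβ hn
    obtain ⟨m, rfl⟩ : ∃ k, m = k + 1 := ⟨m - 1, by omega⟩
    have hn' : n ≤ m := by omega
    have h1 := norm_rec hq0 hq1 hα0 hα hβ0 hβ hn'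
    have h2 := H_rec hq0 hq1 hα0 hα hβ0 hβ hn'
    rw [ih m (α * q) (β * q) (by positivity) (by nlinarith [mul_pos hα0 hq0]) (by positivity)
      (by nlinarith) hn', ← h2, mul_assoc, mul_assoc (qhahnH _ _ _ _ _)] at h1
    refine mul_right_cancel₀ ?_ h1
    have hab : α * β * q < 1 := by nlinarith [mul_pos hα0 hq0]
    have d3 : 1 - α * β * q^(n+2) ≠ 0 := by
      have := (one_sub_pow_pos hq0 hq1 hab (by positivity) (n+1)).ne'
      rwa [show α * β * q * q^(n+1) = α * β * q^(n+2) by ring] at this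
    have k : ∀ l : ℕ, (q^(l+1))⁻¹ ≠ 1 := by
      intro l
      have := pow_lt_one₀ hq0.le hq1 (Nat.succ_ne_zero l)
      simp only [Nat.succ_eq_add_one] at this
      intro h
      rw [inv_eq_one] at h
      linarith
    have k1 := sub_ne_zero.2 (k n)
    have k2 := sub_ne_zero.2 (k m).symm
    have k3 : 1 - α * q ≠ 0 := by linarith
    positivity


set_option maxHeartbeats 4000000 in
lemma H_prime {α β q : ℝ} {n m : ℕ} (hq0 : 0 < q) (hq1 : q < 1) (hα0 : 0 < α)
    (hα : α * q < 1) (hβ0 : 0 < β) (hβ : β < 1) :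
    qhahnH n (α * q) (β / q) m q * ((1 - α * q^(n+1)) * (1 - β * q^n) * (q^m / q^n))
      = qhahnH n α β m q * ((1 - β * q^m) * (1 - α * q)) := by
  have hβ' : β * q < 1 := by nlinarith
  unfold qhahnH
  have t1 : α * q * (β / q) = α * β := by field_simp
  have t2 : β / q * q = β := by field_simp
  rw [t1, t2]
  have s1 := qpoch_shift β q n
  have s2 := qpoch_shift β q m
  have s3 := qpoch_shift (α * q) q n
  have s3e : 1 - α * q * q^n = 1 - α * q^(n+1) := by ring
  rw [s3e] at s3
  have a1 := (qpoch_pos hq0 hq1 (by positivity : 0 < β * q) hβ' m).ne'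
  have a2 := (qpoch_pos hq0 hq1 hβ0 hβ m).ne'
  have a3 := (qpoch_pos hq0 hq1 (by positivity : 0 < α * q) hα n).ne'
  have a4 := (qpoch_pos hq0 hq1 (by positivity : 0 < α * q * q) (by nlinarith [mul_pos hα0 hq0]) n).ne'
  have b1 : 1 - β ≠ 0 := by linarith
  have b2 := (one_sub_pow_pos hq0 hq1 hβ hβ0 n).ne'
  have b3 := (one_sub_pow_pos hq0 hq1 hβ hβ0 m).ne'
  have b4 := (one_sub_pow_pos hq0 hq1 hα (by positivity) n).ne'
  rw [s3e] at b4
  have b5 : 1 - α * q ≠ 0 := by linarith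
  have s1' : qpoch β q n = (1 - β) * qpoch (β * q) q n / (1 - β * q^n) := by rw [s1]; field_simp
  have s2' : qpoch β q m = (1 - β) * qpoch (β * q) q m / (1 - β * q^m) := by rw [s2]; field_simp
  have s3' : qpoch (α * q) q n = (1 - α * q) * qpoch (α * q * q) q n / (1 - α * q^(n+1)) := by
    rw [s3]; field_simp
  have g1 : (-(α * q * q))^n = (-(α * q))^n * q^n := by rw [← mul_pow]; congr 1; ring
  have g2 : (α * q * q)^m = (α * q)^m * q^m := by rw [← mul_pow]
  rw [s1', s2', s3', g1, g2]
  have qm : q^m ≠ 0 := by positivity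
  have qn : q^n ≠ 0 := by positivity
  clear s1 s2 s3 s1' s2' s3' g1 g2 s3e t1 t2 a2 a3
  have hB : (α * q)^m ≠ 0 := by positivity
  generalize (α * q)^m = B1 at *
  generalize (-(α * q))^n = B2 at *
  generalize 1 - α * q^(n+1) = A1 at *
  generalize 1 - β * q^n = A2 at *
  generalize 1 - β * q^m = A3 at *
  generalize 1 - α * q = A4 at *
  generalize 1 - β = A5 at *
  generalize qpoch (α * q * q) q n = C1 at *
  generalize qpoch (q ^ (-(m : ℤ))) q n = C2 at *
  generalize qpoch (α * β * q) q n = C3 at *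
  generalize (1 - α * β * q ^ (2 * n + 1)) = C4 at *
  generalize q ^ ((n.choose 2 : ℤ) - (m : ℤ) * n) = C5 at *
  generalize q^m = M at *
  generalize q^n = N at *
  field_simp

lemma sqrt_mul_eq {a w c u : ℝ} (ha : 0 ≤ a) (hc : 0 ≤ c) (h : a * w = c^2 * u) :
    √a * √w = c * √u := by
  rw [← Real.sqrt_mul ha, h, Real.sqrt_mul (sq_nonneg c), Real.sqrt_sq hc]

section
variable {α β q : ℝ} {m : ℕ}

lemma Je_arg (hq0 : 0 < q) {i : ℕ} (hi : i ≤ m) :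
    (1 - α * q^(i+1)) * (1 - β * q^(m-i)) * q^i = (1 - α * q^(i+1)) * (q^i - β * q^m) := by
  obtain ⟨d, rfl⟩ : ∃ d, m = i + d := ⟨m - i, by omega⟩
  rw [Nat.add_sub_cancel_left]; ring

lemma Jo_arg (hq0 : 0 < q) {i : ℕ} (hi : i ≤ m) :
    (1 - q^(i+1)) * (1 - q^(m-i)) * q^(i+1) * α = (1 - q^(i+1)) * (q^i - q^m) * (α * q) := by
  obtain ⟨d, rfl⟩ : ∃ d, m = i + d := ⟨m - i, by omega⟩
  rw [Nat.add_sub_cancel_left]; ring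

/-- abbreviations -/
noncomputable def Je (α β : ℝ) (m : ℕ) (q : ℝ) (i : ℕ) : ℝ :=
  √((1 - α * q^(i+1)) * (1 - β * q^(m-i)) * q^i)
/-- abbreviations -/
noncomputable def Jo (α : ℝ) (m : ℕ) (q : ℝ) (i : ℕ) : ℝ :=
  √((1 - q^(i+1)) * (1 - q^(m-i)) * q^(i+1) * α)
/-- abbreviations -/
noncomputable def lm (α β : ℝ) (m : ℕ) (q : ℝ) (j : ℕ) : ℝ :=
  (1 - α * q^(j+1)) * (1 - β * q^j) * q^(m-j)

lemma lm_eq (hq0 : 0 < q) {j : ℕ} (hj : j ≤ m) :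
    lm α β m q j = (1 - α * q^(j+1)) * (1 - β * q^j) * (q^m / q^j) := by
  unfold lm
  rw [pow_sub₀ _ hq0.ne' hj, div_eq_mul_inv]

lemma alpha_pos (hq0 : 0 < q) (hq1 : q < 1) (hα0 : 0 < α) (hα : α * q < 1) (i : ℕ) :
    0 < 1 - α * q^(i+1) := by
  have := one_sub_pow_pos hq0 hq1 hα (by positivity) i
  rwa [show α * q * q^i = α * q^(i+1) by ring] at this

lemma lm_pos (hq0 : 0 < q) (hq1 : q < 1) (hα0 : 0 < α) (hα : α * q < 1) (hβ0 : 0 < β)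
    (hβ : β < 1) (j : ℕ) : 0 < lm α β m q j := by
  have h1 := alpha_pos hq0 hq1 hα0 hα j
  have h2 := one_sub_pow_pos hq0 hq1 hβ hβ0 j
  unfold lm; positivity

lemma lm_lt (hq0 : 0 < q) (hq1 : q < 1) (hα0 : 0 < α) (hα : α * q < 1) (hβ0 : 0 < β)
    (hβ : β < 1) {j k : ℕ} (hjk : j < k) (hk : k ≤ m) : lm α β m q j < lm α β m q k := by
  have h1 := alpha_pos hq0 hq1 hα0 hα j
  have h2 := one_sub_pow_pos hq0 hq1 hβ hβ0 j
  have h3 : q^k < q^j := pow_lt_pow_right_of_lt_one₀ hq0 hq1 hjk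
  have h4 : q^(k+1) < q^(j+1) := pow_lt_pow_right_of_lt_one₀ hq0 hq1 (by omega)
  have h5 : q^(m-j) < q^(m-k) := pow_lt_pow_right_of_lt_one₀ hq0 hq1 (by omega)
  unfold lm
  have h6 : 1 - α * q^(j+1) < 1 - α * q^(k+1) := by nlinarith
  have h7 : 1 - β * q^j < 1 - β * q^k := by nlinarith
  gcongr
  
lemma lm_inj (hq0 : 0 < q) (hq1 : q < 1) (hα0 : 0 < α) (hα : α * q < 1) (hβ0 : 0 < β)
    (hβ : β < 1) {j k : ℕ} (hj : j ≤ m) (hk : k ≤ m) (h : lm α β m q j = lm α β m q k) :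
    j = k := by
  rcases lt_trichotomy j k with h1 | h1 | h1
  · have := lm_lt hq0 hq1 hα0 hα hβ0 hβ h1 hk; linarith
  · exact h1
  · have := lm_lt hq0 hq1 hα0 hα hβ0 hβ h1 hj; linarith

lemma H_pos (hq0 : 0 < q) (hq1 : q < 1) (hα0 : 0 < α) (hα : α * q < 1) (hβ0 : 0 < β)
    (hβ : β < 1) {j : ℕ} (hj : j ≤ m) : 0 < qhahnH j α β m q := by
  have hβ' : β * q < 1 := by nlinarith
  rw [← norm_eq hq0 hq1 j m α β hα0 hα hβ0 hβ hj]
  refine Finset.sum_pos' (fun x hx => ?_) ⟨0, by simp, ?_⟩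
  · have hx' : x ≤ m := by have := Finset.mem_range.1 hx; omega
    have := W_pos hq0 hq1 hα0 hα hβ0 hβ' x hx'
    positivity
  · simp [W_zero, Q_zero_x]

lemma S5 (hq0 : 0 < q) (hq1 : q < 1) (hα0 : 0 < α) (hα : α * q < 1) (hβ0 : 0 < β)
    (hβ : β < 1) {j : ℕ} (hj : j ≤ m) :
    √(lm α β m q j) * √(qhahnH j (α * q) (β / q) m q)
      = √((1 - β * q^m) / (1 - α * q)) * (1 - α * q) * √(qhahnH j α β m q) := by
  have h1 := one_sub_pow_pos hq0 hq1 hβ hβ0 m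
  have h2 : 0 < 1 - α * q := by linarith
  refine sqrt_mul_eq (lm_pos hq0 hq1 hα0 hα hβ0 hβ j).le (by positivity) ?_
  rw [mul_pow, Real.sq_sqrt (by positivity), lm_eq hq0 hj]
  have := H_prime (n := j) (m := m) hq0 hq1 hα0 hα hβ0 hβ
  rw [mul_comm, this]
  field_simp

lemma H'_pos (hq0 : 0 < q) (hq1 : q < 1) (hα0 : 0 < α) (hα : α * q < 1) (hβ0 : 0 < β)
    (hβ : β < 1) {j : ℕ} (hj : j ≤ m) : 0 < qhahnH j (α * q) (β / q) m q := by
  have h := H_prime (n := j) (m := m) hq0 hq1 hα0 hα hβ0 hβ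
  rw [← lm_eq hq0 hj] at h
  have h1 := one_sub_pow_pos hq0 hq1 hβ hβ0 m
  have h2 : 0 < 1 - α * q := by linarith
  have h3 := H_pos hq0 hq1 hα0 hα hβ0 hβ hj
  have h4 := lm_pos (m := m) hq0 hq1 hα0 hα hβ0 hβ j
  have h7 : 0 < qhahnH j α β m q * ((1 - β * q ^ m) * (1 - α * q)) := by positivity
  rw [← h] at h7
  exact (pos_iff_pos_of_mul_pos h7).2 h4

lemma S1 (hq0 : 0 < q) (hq1 : q < 1) (hα0 : 0 < α) (hα : α * q < 1) (hβ0 : 0 < β)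
    (hβ : β < 1) {i : ℕ} (hi : i ≤ m) :
    Je α β m q i * √(qhahnW i (α * q) (β / q) m q)
      = √((1 - β * q^m) / (1 - α * q)) * (1 - α * q^(i+1)) * √(qhahnW i α β m q) := by
  have h1 := one_sub_pow_pos hq0 hq1 hβ hβ0 m
  have h2 : 0 < 1 - α * q := by linarith
  have h3 := alpha_pos hq0 hq1 hα0 hα i
  have h4 := pow_sub_pos'' hq0 hq1 hβ0 hβ hi
  unfold Je
  rw [Je_arg hq0 hi]
  refine sqrt_mul_eq (by positivity) (by positivity) ?_
  rw [mul_pow, Real.sq_sqrt (by positivity)]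
  have := W_prime hq0 hq1 hα0 hβ0 hβ i hi
  generalize 1 - α * q = D at *
  field_simp
  linear_combination this

lemma S3 (hq0 : 0 < q) (hq1 : q < 1) (hα0 : 0 < α) (hα : α * q < 1) (hβ0 : 0 < β)
    (hβ : β < 1) {i : ℕ} (hi : i ≤ m) :
    Je α β m q i * √(qhahnW i α β m q)
      = (√((1 - β * q^m) / (1 - α * q)))⁻¹ * (q^i - β * q^m)
        * √(qhahnW i (α * q) (β / q) m q) := by
  have h1 := one_sub_pow_pos hq0 hq1 hβ hβ0 m
  have h2 : 0 < 1 - α * q := by linarith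
  have h3 := alpha_pos hq0 hq1 hα0 hα i
  have h4 := pow_sub_pos'' hq0 hq1 hβ0 hβ hi
  unfold Je
  rw [Je_arg hq0 hi]
  refine sqrt_mul_eq (by positivity) (by positivity) ?_
  rw [mul_pow, inv_pow, Real.sq_sqrt (by positivity)]
  have := W_prime hq0 hq1 hα0 hβ0 hβ i hi
  generalize 1 - α * q = D at *
  generalize 1 - β * q^m = D' at *
  field_simp
  linear_combination -this

lemma W_rel (hq0 : 0 < q) (hq1 : q < 1) (hα0 : 0 < α) (hα : α * q < 1) (hβ0 : 0 < β)
    (hβ : β < 1) {i : ℕ} (hi : i < m) :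
    qhahnW i (α * q) (β / q) m q * ((1 - α * q) * (q^i - q^m))
      = qhahnW (i+1) α β m q * ((1 - q^(i+1)) * (α * q) * (1 - β * q^m)) := by
  have hβ' : β * q < 1 := by nlinarith
  have h1 := W_prime hq0 hq1 hα0 hβ0 hβ i hi.le
  have h2 := W_succ hq0 hq1 hα0 hβ0 hβ' hi
  have h4 := pow_sub_pos'' hq0 hq1 hβ0 hβ hi.le
  apply mul_right_cancel₀ h4.ne'
  linear_combination (q^i - q^m) * h1 - (1 - β * q^m) * h2

lemma S2 (hq0 : 0 < q) (hq1 : q < 1) (hα0 : 0 < α) (hα : α * q < 1) (hβ0 : 0 < β)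
    (hβ : β < 1) {i : ℕ} (hi : i < m) :
    Jo α m q i * √(qhahnW i (α * q) (β / q) m q)
      = √((1 - β * q^m) / (1 - α * q)) * (α * q * (1 - q^(i+1))) * √(qhahnW (i+1) α β m q) := by
  have h1 := one_sub_pow_pos hq0 hq1 hβ hβ0 m
  have h2 : 0 < 1 - α * q := by linarith
  have h3 : 0 < 1 - q^(i+1) := by
    have := pow_lt_one₀ hq0.le hq1 (Nat.succ_ne_zero i); simpa using this
  have h4 : 0 < q^i - q^m := by
    have := pow_lt_pow_right_of_lt_one₀ hq0 hq1 hi; linarith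
  unfold Jo
  rw [Jo_arg hq0 hi.le]
  refine sqrt_mul_eq (by positivity) (by positivity) ?_
  rw [mul_pow, Real.sq_sqrt (by positivity)]
  have := W_rel hq0 hq1 hα0 hα hβ0 hβ hi
  generalize 1 - α * q = D at *
  field_simp
  linear_combination this

lemma S4 (hq0 : 0 < q) (hq1 : q < 1) (hα0 : 0 < α) (hα : α * q < 1) (hβ0 : 0 < β)
    (hβ : β < 1) {i : ℕ} (hi : i ≤ m) :
    Jo α m q i * √(qhahnW (i+1) α β m q)
      = (√((1 - β * q^m) / (1 - α * q)))⁻¹ * (q^i - q^m) * √(qhahnW i (α * q) (β / q) m q) := by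
  have h1 := one_sub_pow_pos hq0 hq1 hβ hβ0 m
  have h2 : 0 < 1 - α * q := by linarith
  have h3 : 0 < 1 - q^(i+1) := by
    have := pow_lt_one₀ hq0.le hq1 (Nat.succ_ne_zero i); simpa using this
  unfold Jo
  rw [Jo_arg hq0 hi]
  rcases hi.eq_or_lt with rfl | hi
  · simp
  have h4 : 0 < q^i - q^m := by
    have := pow_lt_pow_right_of_lt_one₀ hq0 hq1 hi; linarith
  refine sqrt_mul_eq (by positivity) (by positivity) ?_
  rw [mul_pow, inv_pow, Real.sq_sqrt (by positivity)]
  have := W_rel hq0 hq1 hα0 hα hβ0 hβ hi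
  generalize 1 - α * q = D at *
  generalize 1 - β * q^m = D' at *
  field_simp
  linear_combination -this

lemma even_zero (hq0 : 0 < q) (hq1 : q < 1) (hα0 : 0 < α) (hα : α * q < 1) (hβ0 : 0 < β)
    (hβ : β < 1) {j : ℕ} (hj : j ≤ m) :
    Je α β m q 0 * qhahnQt j 0 (α * q) (β / q) m q = √(lm α β m q j) * qhahnQt j 0 α β m q := by
  have h1 := S1 hq0 hq1 hα0 hα hβ0 hβ (Nat.zero_le m)
  have h5 := S5 hq0 hq1 hα0 hα hβ0 hβ hj
  have a1 := Real.sqrt_pos.2 (H_pos hq0 hq1 hα0 hα hβ0 hβ hj)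
  have a2 := Real.sqrt_pos.2 (H'_pos hq0 hq1 hα0 hα hβ0 hβ hj)
  unfold qhahnQt
  rw [Q_zero_x, Q_zero_x]
  rw [zero_add, pow_one] at h1
  field_simp
  linear_combination √(qhahnH j α β m q) * h1 - √(qhahnW 0 α β m q) * h5

lemma even_succ (hq0 : 0 < q) (hq1 : q < 1) (hα0 : 0 < α) (hα : α * q < 1) (hβ0 : 0 < β)
    (hβ : β < 1) {i j : ℕ} (hj : j ≤ m) (hi : i < m) :
    Je α β m q (i+1) * qhahnQt j (i+1) (α * q) (β / q) m q
      - Jo α m q i * qhahnQt j i (α * q) (β / q) m q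
      = √(lm α β m q j) * qhahnQt j (i+1) α β m q := by
  have h1 := S1 hq0 hq1 hα0 hα hβ0 hβ (show i + 1 ≤ m from hi)
  have h2 := S2 hq0 hq1 hα0 hα hβ0 hβ hi
  have h5 := S5 hq0 hq1 hα0 hα hβ0 hβ hj
  have a1 := Real.sqrt_pos.2 (H_pos hq0 hq1 hα0 hα hβ0 hβ hj)
  have a2 := Real.sqrt_pos.2 (H'_pos hq0 hq1 hα0 hα hβ0 hβ hj)
  have r := R1 (β := β) j m i hq0 hq1 hα0 hα
  unfold qhahnQt
  generalize qhahnQ j (i+1) (α * q) (β / q) m q = g1 at *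
  generalize qhahnQ j i (α * q) (β / q) m q = g0 at *
  generalize qhahnQ j (i+1) α β m q = f at *
  generalize √(qhahnH j α β m q) = h at *
  generalize √(qhahnH j (α * q) (β / q) m q) = h' at *
  generalize √((1 - β * q^m) / (1 - α * q)) = C at *
  generalize √(qhahnW (i+1) α β m q) = w at *
  have e : i + 1 + 1 = i + 2 := rfl
  rw [e] at h1
  field_simp
  linear_combination h * g1 * h1 - h * g0 * h2 - w * f * h5 + h * C * w * r

lemma odd_rel (hq0 : 0 < q) (hq1 : q < 1) (hα0 : 0 < α) (hα : α * q < 1) (hβ0 : 0 < β)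
    (hβ : β < 1) {i j : ℕ} (hj : j ≤ m) (hi : i ≤ m) :
    Je α β m q i * qhahnQt j i α β m q - Jo α m q i * qhahnQt j (i+1) α β m q
      = √(lm α β m q j) * qhahnQt j i (α * q) (β / q) m q := by
  have h1 := S3 hq0 hq1 hα0 hα hβ0 hβ hi
  have h2 := S4 hq0 hq1 hα0 hα hβ0 hβ hi
  have h5 := S5 hq0 hq1 hα0 hα hβ0 hβ hj
  have a1 := Real.sqrt_pos.2 (H_pos hq0 hq1 hα0 hα hβ0 hβ hj)
  have a2 := Real.sqrt_pos.2 (H'_pos hq0 hq1 hα0 hα hβ0 hβ hj)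
  have r := R2 (β := β) i hq0 hq1 hα0 hα hj
  have b1 := one_sub_pow_pos hq0 hq1 hβ hβ0 m
  have b2 : 0 < 1 - α * q := by linarith
  have a3 : 0 < √((1 - β * q^m) / (1 - α * q)) := Real.sqrt_pos.2 (by positivity)
  have hl := Real.mul_self_sqrt (lm_pos (m := m) hq0 hq1 hα0 hα hβ0 hβ j).le
  rw [← lm_eq hq0 hj, ← hl] at r
  unfold qhahnQt
  generalize qhahnQ j (i+1) α β m q = f1 at *
  generalize qhahnQ j i α β m q = f0 at *
  generalize qhahnQ j i (α * q) (β / q) m q = g at *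
  generalize √(qhahnH j α β m q) = h at *
  generalize √(qhahnH j (α * q) (β / q) m q) = h' at *
  generalize √((1 - β * q^m) / (1 - α * q)) = C at *
  generalize √(qhahnW (i+1) α β m q) = w1 at *
  generalize √(qhahnW i α β m q) = w0 at *
  generalize √(qhahnW i (α * q) (β / q) m q) = w' at *
  generalize √(lm α β m q j) = L at *
  have h5' : h = L * h' / (C * (1 - α * q)) := by rw [h5]; field_simp
  have r' : (q^i - β * q^m) * f0 - (q^i - q^m) * f1 = L * L * g / (1 - α * q) := by
    rw [← r]; field_simp
  have key : Je α β m q i * w0 * f0 - Jo α m q i * w1 * f1 = C⁻¹ * w' * (L * L * g / (1 - α * q)) := by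
    rw [h1, h2, ← r']; ring
  have : Je α β m q i * (w0 * f0 / h) - Jo α m q i * (w1 * f1 / h)
     = (Je α β m q i * w0 * f0 - Jo α m q i * w1 * f1) / h := by ring
  rw [this, key]
  rw [div_eq_iff a1.ne', h5']
  generalize 1 - α * q = D at *
  field_simp

lemma norm_one (hq0 : 0 < q) (hq1 : q < 1) (hα0 : 0 < α) (hα : α * q < 1) (hβ0 : 0 < β)
    (hβ : β < 1) {j : ℕ} (hj : j ≤ m) :
    ∑ i ∈ Finset.range (m+1), qhahnQt j i α β m q ^ 2 = 1 := by
  have hβ' : β * q < 1 := by nlinarith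
  have h := norm_eq hq0 hq1 j m α β hα0 hα hβ0 hβ hj
  have hp := H_pos hq0 hq1 hα0 hα hβ0 hβ hj
  have : ∀ i ∈ Finset.range (m+1), qhahnQt j i α β m q ^ 2 = 
     (qhahnW i α β m q * qhahnQ j i α β m q ^ 2) / qhahnH j α β m q := by
    intro i hi
    have hi' : i ≤ m := by have := Finset.mem_range.1 hi; omega
    unfold qhahnQt
    rw [div_pow, mul_pow, Real.sq_sqrt hp.le, Real.sq_sqrt (W_pos hq0 hq1 hα0 hα hβ0 hβ' i hi').le]
  rw [Finset.sum_congr rfl this, ← Finset.sum_div, h, div_self hp.ne']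
end


lemma tri_sum (N r : ℕ) (J v : ℕ → ℝ) :
    ∑ s : Fin N, (if r + 1 = (s : ℕ) then J r else if (s : ℕ) + 1 = r then J s else 0) * v s
     = (if r + 1 < N then J r * v (r+1) else 0)
       + (if 0 < r ∧ r - 1 < N then J (r-1) * v (r-1) else 0) := by
  rw [Fin.sum_univ_eq_sum_range
    (fun s => (if r + 1 = s then J r else if s + 1 = r then J s else 0) * v s) N]
  have : ∀ s ∈ Finset.range N, (if r + 1 = s then J r else if s + 1 = r then J s else 0) * v s
      = (if r + 1 = s then J r * v s else 0) + (if s + 1 = r then J s * v s else 0) := by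
    intro s _
    by_cases h1 : r + 1 = s
    · have : ¬ (s + 1 = r) := by omega
      simp [h1, this]
    · by_cases h2 : s + 1 = r <;> simp [h1, h2]
  rw [Finset.sum_congr rfl this, Finset.sum_add_distrib, Finset.sum_ite_eq]
  congr 1
  · simp
  · cases r with
    | zero => simp
    | succ k =>
      simp only [Nat.add_right_cancel_iff]
      rw [Finset.sum_ite_eq']
      simp

/-- sign of the column -/
noncomputable def sg (m c : ℕ) : ℝ := if c ≤ m then -1 else 1
/-- index of the column -/
def jj (m c : ℕ) : ℕ := if c ≤ m then m - c else c - m - 1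
/-- entries of `U` indexed by naturals -/
noncomputable def uu (α β : ℝ) (m : ℕ) (q : ℝ) (r c : ℕ) : ℝ :=
  if r % 2 = 0 then ((-1 : ℝ) ^ (r/2) / √2) * qhahnQt (jj m c) (r/2) α β m q
  else sg m c * ((-1 : ℝ) ^ (r/2) / √2) * qhahnQt (jj m c) (r/2) (α * q) (β / q) m q

lemma U_eq (α β : ℝ) (m : ℕ) (q : ℝ) (r c : Fin (2*m+2)) :
    qhahnU α β m q r c = uu α β m q r c := rfl

lemma eps_eq (α β : ℝ) (m : ℕ) (q : ℝ) (c : Fin (2*m+2)) :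
    qhahnEps α β m q c = sg m c * (2 * √(lm α β m q (jj m c))) := by
  unfold qhahnEps sg jj lm
  by_cases h : (c : ℕ) ≤ m
  · simp only [h, if_true]; ring
  · simp only [h, if_false]; ring

lemma sg_sq (m c : ℕ) : sg m c * sg m c = 1 := by
  unfold sg; split_ifs <;> norm_num

lemma jj_le {m c : ℕ} (h : c < 2*m+2) : jj m c ≤ m := by
  unfold jj; split_ifs <;> omega

lemma J_even (α β : ℝ) (m : ℕ) (q : ℝ) (i : ℕ) : qhahnJ α β m q (2*i) = 2 * Je α β m q i := by
  have h1 : 2 * i % 2 = 0 := by omega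
  have h2 : 2 * i / 2 = i := by omega
  simp only [qhahnJ, h1, h2, Je, if_true]

lemma J_odd (α β : ℝ) (m : ℕ) (q : ℝ) (i : ℕ) : qhahnJ α β m q (2*i+1) = 2 * Jo α m q i := by
  have h1 : ¬ (2 * i + 1) % 2 = 0 := by omega
  have h2 : (2 * i + 1) / 2 = i := by omega
  simp only [qhahnJ, h1, h2, Jo, if_false]

lemma uu_even (α β : ℝ) (m : ℕ) (q : ℝ) (i c : ℕ) : uu α β m q (2*i) c =
    ((-1 : ℝ) ^ i / √2) * qhahnQt (jj m c) i α β m q := by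
  have h1 : 2 * i % 2 = 0 := by omega
  have h2 : 2 * i / 2 = i := by omega
  simp only [uu, h1, h2, if_true]

lemma uu_odd (α β : ℝ) (m : ℕ) (q : ℝ) (i c : ℕ) : uu α β m q (2*i+1) c =
    sg m c * ((-1 : ℝ) ^ i / √2) * qhahnQt (jj m c) i (α * q) (β / q) m q := by
  have h1 : ¬ (2 * i + 1) % 2 = 0 := by omega
  have h2 : (2 * i + 1) / 2 = i := by omega
  simp only [uu, h1, h2, if_false]

lemma sum_two (f : ℕ → ℝ) (k : ℕ) :
    ∑ s ∈ Finset.range (2*k), f s = ∑ i ∈ Finset.range k, (f (2*i) + f (2*i+1)) := by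
  induction k with
  | zero => simp
  | succ k ih =>
    rw [show 2 * (k+1) = 2*k+1+1 by ring, Finset.sum_range_succ, Finset.sum_range_succ, ih,
      Finset.sum_range_succ _ k]
    ring

section
variable {α β q : ℝ} {m : ℕ}

lemma MU_eq (hq0 : 0 < q) (hq1 : q < 1) (hα0 : 0 < α) (hα : α * q < 1) (hβ0 : 0 < β)
    (hβ : β < 1) :
    qhahnM α β m q * qhahnU α β m q = qhahnU α β m q * Matrix.diagonal (qhahnEps α β m q) := by
  ext r c
  rw [Matrix.mul_diagonal, Matrix.mul_apply]
  simp only [U_eq, eps_eq]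
  have hj := jj_le c.2
  have ht := tri_sum (2*m+2) r (qhahnJ α β m q) (fun s => uu α β m q s c)
  have hM : ∀ s : Fin (2*m+2), qhahnM α β m q r s = if (r : ℕ) + 1 = (s : ℕ) then qhahnJ α β m q r
    else if (s : ℕ) + 1 = r then qhahnJ α β m q s else 0 := fun s => rfl
  simp only [hM]
  rw [ht]
  have hr := r.2
  generalize (r : ℕ) = r' at *
  generalize (c : ℕ) = c' at *
  have hs := sg_sq m c'
  rcases Nat.even_or_odd' r' with ⟨i, rfl | rfl⟩
  · rw [if_pos (by omega), J_even, uu_odd, uu_even]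
    cases i with
    | zero =>
      simp only [mul_zero, lt_self_iff_false, false_and, if_false, add_zero, pow_zero]
      have := even_zero hq0 hq1 hα0 hα hβ0 hβ hj
      linear_combination 2 * sg m c' * (1 / √2) * this
    | succ i =>
      rw [if_pos (by omega), show 2 * (i+1) - 1 = 2*i+1 by omega, J_odd, uu_odd]
      have := even_succ hq0 hq1 hα0 hα hβ0 hβ hj (show i < m by omega)
      rw [pow_succ]
      linear_combination -2 * sg m c' * ((-1)^i / √2) * this
  · have := odd_rel hq0 hq1 hα0 hα hβ0 hβ hj (show i ≤ m by omega)
    rw [if_pos (show 0 < 2*i+1 ∧ 2*i+1-1 < 2*m+2 by omega), show 2*i+1-1 = 2*i by omega, J_even,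
      uu_even, uu_odd]
    have h2 : (if 2*i+1+1 < 2*m+2 then qhahnJ α β m q (2*i+1) * uu α β m q (2*i+1+1) c' else 0)
      = -(2 * Jo α m q i * ((-1)^i / √2) * qhahnQt (jj m c') (i+1) α β m q) := by
      split_ifs with h
      · rw [J_odd, show 2*i+1+1 = 2*(i+1) by ring, uu_even, pow_succ]; ring
      · have : i = m := by omega
        subst this
        simp [Jo]
    rw [h2]
    linear_combination 2 * ((-1)^i / √2) * this
      - 2 * ((-1)^i / √2) * √(lm α β m q (jj m c')) * qhahnQt (jj m c') i (α * q) (β / q) m q * hs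

lemma eps_inj (hq0 : 0 < q) (hq1 : q < 1) (hα0 : 0 < α) (hα : α * q < 1) (hβ0 : 0 < β)
    (hβ : β < 1) {c d : Fin (2*m+2)} (h : qhahnEps α β m q c = qhahnEps α β m q d) : c = d := by
  rw [eps_eq, eps_eq] at h
  have hc := c.2
  have hd := d.2
  have jc := jj_le hc
  have jd := jj_le hd
  have pc := Real.sqrt_pos.2 (lm_pos (m := m) hq0 hq1 hα0 hα hβ0 hβ (jj m c))
  have pd := Real.sqrt_pos.2 (lm_pos (m := m) hq0 hq1 hα0 hα hβ0 hβ (jj m d))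
  have hinj : √(lm α β m q (jj m c)) = √(lm α β m q (jj m d)) → jj m c = jj m d := by
    intro h
    rw [Real.sqrt_inj (lm_pos hq0 hq1 hα0 hα hβ0 hβ _).le (lm_pos hq0 hq1 hα0 hα hβ0 hβ _).le] at h
    exact lm_inj hq0 hq1 hα0 hα hβ0 hβ jc jd h
  ext
  unfold sg at h
  by_cases h1 : (c : ℕ) ≤ m <;> by_cases h2 : (d : ℕ) ≤ m <;> simp only [h1, h2, if_true, if_false] at h
  · have := hinj (by linarith)
    simp only [jj, h1, h2, if_true] at this
    omega
  · linarith
  · linarith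
  · have := hinj (by linarith)
    simp only [jj, h1, h2, if_false] at this
    omega

lemma M_symm : (qhahnM α β m q)ᵀ = qhahnM α β m q := by
  ext r c
  simp only [Matrix.transpose_apply, qhahnM, Matrix.of_apply]
  by_cases h1 : (c : ℕ) + 1 = r
  · have : ¬ ((r : ℕ) + 1 = c) := by omega
    simp [h1, this]
  · simp [h1]

lemma UU_off (hq0 : 0 < q) (hq1 : q < 1) (hα0 : 0 < α) (hα : α * q < 1) (hβ0 : 0 < β)
    (hβ : β < 1) {c d : Fin (2*m+2)} (hcd : c ≠ d) :
    ((qhahnU α β m q)ᵀ * qhahnU α β m q) c d = 0 := by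
  have h := MU_eq (m := m) hq0 hq1 hα0 hα hβ0 hβ
  have h1 : (qhahnU α β m q)ᵀ * qhahnM α β m q * qhahnU α β m q
      = (qhahnU α β m q)ᵀ * qhahnU α β m q * Matrix.diagonal (qhahnEps α β m q) := by
    rw [Matrix.mul_assoc, h, Matrix.mul_assoc]
  have h2 : (qhahnU α β m q)ᵀ * qhahnM α β m q * qhahnU α β m q
      = Matrix.diagonal (qhahnEps α β m q) * ((qhahnU α β m q)ᵀ * qhahnU α β m q) := by
    have h3 := congrArg Matrix.transpose h
    rw [Matrix.transpose_mul, Matrix.transpose_mul, M_symm, Matrix.diagonal_transpose] at h3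
    rw [h3, Matrix.mul_assoc]
  have h4 := congrFun (congrFun (h1.symm.trans h2) c) d
  rw [Matrix.mul_diagonal, Matrix.diagonal_mul] at h4
  have h5 : qhahnEps α β m q d - qhahnEps α β m q c ≠ 0 := by
    intro h
    exact hcd (eps_inj hq0 hq1 hα0 hα hβ0 hβ (by linarith))
  apply mul_right_cancel₀ h5
  linear_combination h4

lemma UU_apply (c d : Fin (2*m+2)) (hj : jj m c = jj m d) :
    ((qhahnU α β m q)ᵀ * qhahnU α β m q) c d =
     (1/2) * ∑ i ∈ Finset.range (m+1), qhahnQt (jj m c) i α β m q ^ 2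
      + sg m c * sg m d * ((1/2) * ∑ i ∈ Finset.range (m+1),
          qhahnQt (jj m c) i (α * q) (β / q) m q ^ 2) := by
  rw [Matrix.mul_apply]
  simp only [Matrix.transpose_apply, U_eq]
  rw [Fin.sum_univ_eq_sum_range (fun s => uu α β m q s c * uu α β m q s d) (2*m+2)]
  refine (sum_two (fun s => uu α β m q s c * uu α β m q s d) (m+1)).trans ?_
  rw [Finset.mul_sum, Finset.mul_sum, Finset.mul_sum,
    ← Finset.sum_add_distrib]
  refine Finset.sum_congr rfl fun i _ => ?_
  rw [uu_even, uu_even, uu_odd, uu_odd, ← hj]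
  have h : ((-1 : ℝ)^i / √2) * ((-1)^i / √2) = 1/2 := by
    rw [div_mul_div_comm, ← mul_pow, Real.mul_self_sqrt (by norm_num)]; norm_num
  linear_combination (qhahnQt (jj m c) i α β m q ^ 2 +
    sg m c * sg m d * qhahnQt (jj m c) i (α * q) (β / q) m q ^ 2) * h

lemma UU_one (hq0 : 0 < q) (hq1 : q < 1) (hα0 : 0 < α) (hα : α * q < 1) (hβ0 : 0 < β)
    (hβ : β < 1) : (qhahnU α β m q)ᵀ * qhahnU α β m q = 1 := by
  ext c d
  by_cases hcd : c = d
  · subst hcd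
    rw [Matrix.one_apply_eq]
    have hc := c.2
    let c' : Fin (2*m+2) := ⟨2*m+1-c, by omega⟩
    have e1 : jj m c = jj m c' := by
      simp only [jj, c']
      split_ifs <;> omega
    have e2 : sg m c * sg m c' = -1 := by
      simp only [sg, c']
      split_ifs <;> first | omega | norm_num
    have hne : c ≠ c' := by
      intro h
      have := congrArg Fin.val h
      simp only [c'] at this
      omega
    have h0 := UU_off hq0 hq1 hα0 hα hβ0 hβ hne
    rw [UU_apply c c' e1, e2, norm_one hq0 hq1 hα0 hα hβ0 hβ (jj_le hc)] at h0
    rw [UU_apply c c rfl, sg_sq, norm_one hq0 hq1 hα0 hα hβ0 hβ (jj_le hc)]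
    linarith
  · rw [UU_off hq0 hq1 hα0 hα hβ0 hβ hcd, Matrix.one_apply_ne hcd]
end


theorem qhahn_spin_chain_diagonalization (m : ℕ) (α β q : ℝ)
    (hq0 : 0 < q) (hq1 : q < 1) (hα0 : 0 < α) (hα1 : α < q⁻¹) (hβ0 : 0 < β) (hβ1 : β < 1) :
    qhahnM α β m q * qhahnU α β m q
        = qhahnU α β m q * Matrix.diagonal (qhahnEps α β m q) ∧
    (qhahnU α β m q)ᵀ * qhahnU α β m q = 1 ∧
    qhahnU α β m q * (qhahnU α β m q)ᵀ = 1 := by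
  have hα : α * q < 1 := by
    have := mul_lt_mul_of_pos_right hα1 hq0
    rwa [inv_mul_cancel₀ hq0.ne'] at this
  have h := UU_one (m := m) hq0 hq1 hα0 hα hβ0 hβ1
  exact ⟨MU_eq hq0 hq1 hα0 hα hβ0 hβ1, h, mul_eq_one_comm.1 h⟩
end
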